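/- arXiv:1910.01475 — 5 statements merged into one kernel-verified Lean document; each statement's English description precedes it below -/
import Mathlib

section
/- For every inner function φ: 𝔻 → 𝔻 there exists w ∈ H² such that the weighted composition operator T_{w,φ} is an isometry on the Hardy space H². -/
open Complex Metric Filter Topology MeasureTheory

/-- The Hardy space `H²`, realized as the sequence space `ℓ²` of Taylor coefficients. -/
noncomputable abbrev H2 : Type := lp (fun _ : ℕ => ℂ) 2

/-- Evaluation of an element of `H²` (a coefficient sequence) at a point of the disc. -/
noncomputable def H2.eval (f : H2) (z : ℂ) : ℂ := ∑' n : ℕ, f n * z ^ n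

/-- A bounded holomorphic function on the unit disc is *inner* if its radial boundary
values have modulus one almost everywhere on the unit circle. -/
def IsInnerFn (φ : ℂ → ℂ) : Prop :=
  DifferentiableOn ℂ φ (ball (0:ℂ) 1) ∧ (∀ z ∈ ball (0:ℂ) 1, ‖φ z‖ ≤ 1) ∧
    ∀ᵐ θ : ℝ, ∃ l : ℂ, ‖l‖ = 1 ∧
      Tendsto (fun r : ℝ => φ ((r : ℂ) * Complex.exp (θ * Complex.I)))
        (𝓝[<] (1:ℝ)) (𝓝 l)

section helpers
open ComplexConjugate Real

lemma hp_congr {f g : ℕ → ℂ} {x : ℂ} (h : ∀ n, f n = g n) (hg : HasSum g x) : HasSum f x := by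
  rw [funext h]; exact hg

lemma hp_exists_coeff {F : ℂ → ℂ} (hF : DifferentiableOn ℂ F (ball 0 1)) :
    ∃ a : ℕ → ℂ, ∀ z ∈ ball (0:ℂ) 1, HasSum (fun n => a n * z ^ n) (F z) := by
  refine ⟨fun n => ((n.factorial : ℂ))⁻¹ * iteratedDeriv n F 0, fun z hz => ?_⟩
  have := Complex.hasSum_taylorSeries_on_ball hF hz
  simp only [sub_zero, smul_eq_mul] at this
  refine hp_congr (fun n => ?_) this
  ring

lemma hp_mem {r : ℝ} (h0 : 0 ≤ r) (h1 : r < 1) (t : ℝ) : circleMap 0 r t ∈ ball (0:ℂ) 1 := by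
  simp [abs_of_nonneg h0, h1]

lemma hp_cont {K : ℂ → ℂ} (hK : ContinuousOn K (ball 0 1)) {r : ℝ} (h0 : 0 ≤ r) (h1 : r < 1) :
    Continuous fun t => K (circleMap 0 r t) :=
  hK.comp_continuous (continuous_circleMap 0 r) (hp_mem h0 h1)

lemma hp_ci {K : ℂ → ℂ} (hK : ContinuousOn K (ball 0 1)) {r : ℝ} (h0 : 0 ≤ r) (h1 : r < 1) :
    CircleIntegrable K 0 r := by
  apply ContinuousOn.circleIntegrable h0 (hK.mono _)
  intro z hz
  simp at hz ⊢
  linarith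

lemma hp_mean {K : ℂ → ℂ} (hK : DifferentiableOn ℂ K (ball 0 1)) {r : ℝ} (h0 : 0 ≤ r)
    (h1 : r < 1) : circleAverage K 0 r = K 0 := by
  apply DiffContOnCl.circleAverage
  apply DifferentiableOn.diffContOnCl
  apply hK.mono
  apply closure_ball_subset_closedBall.trans
  rw [abs_of_nonneg h0]
  exact closedBall_subset_ball h1

lemma hp_conj {K : ℂ → ℂ} (hK : ContinuousOn K (ball 0 1)) {r : ℝ} (h0 : 0 ≤ r) (h1 : r < 1) :
    circleAverage (fun z => conj (K z)) 0 r = conj (circleAverage K 0 r) :=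
  ContinuousLinearMap.circleAverage_comp_comm (conjCLE : ℂ →L[ℝ] ℂ) (hp_ci hK h0 h1)

lemma hp_sum {F K : ℂ → ℂ} {a : ℕ → ℂ}
    (ha : ∀ z ∈ ball (0:ℂ) 1, HasSum (fun n => a n * z ^ n) (F z))
    (hK : ContinuousOn K (ball 0 1)) {r : ℝ} (h0 : 0 ≤ r) (h1 : r < 1) :
    HasSum (fun n => a n * circleAverage (fun z => z ^ n * K z) 0 r)
      (circleAverage (fun z => F z * K z) 0 r) := by
  have hs : Summable fun n => ‖a n‖ * r ^ n := by
    have := (ha (r : ℂ) (by simp [abs_of_nonneg h0, h1])).summable.norm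
    simpa [abs_of_nonneg h0] using this
  have hKc := hp_cont hK h0 h1
  have key := intervalIntegral.hasSum_integral_of_dominated_convergence (μ := volume)
    (a := 0) (b := 2 * π)
    (F := fun n t => a n * (circleMap 0 r t ^ n * K (circleMap 0 r t)))
    (f := fun t => F (circleMap 0 r t) * K (circleMap 0 r t))
    (fun n t => ‖a n‖ * r ^ n * ‖K (circleMap 0 r t)‖)
    (fun n => by
      apply Continuous.aestronglyMeasurable
      exact continuous_const.mul (((continuous_circleMap 0 r).pow n).mul hKc))
    (fun n => by
      filter_upwards with t _
      simp [abs_of_nonneg h0, mul_assoc])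
    (by
      filter_upwards with t _
      exact hs.mul_right _)
    (by
      simp_rw [tsum_mul_right]
      apply Continuous.intervalIntegrable
      exact continuous_const.mul hKc.norm)
    (by
      filter_upwards with t _
      have := (ha _ (hp_mem h0 h1 t)).mul_right (K (circleMap 0 r t))
      simpa [mul_assoc] using this)
  simp_rw [intervalIntegral.integral_const_mul] at key
  have := key.const_smul ((2 * π)⁻¹ : ℝ)
  simp only [circleAverage_def]
  refine hp_congr (fun n => ?_) this
  simp only [Complex.real_smul]
  ring

lemma hp_orth {r : ℝ} (h0 : 0 ≤ r) (h1 : r < 1) (m n : ℕ) :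
    circleAverage (fun z => z ^ m * conj (z ^ n)) 0 r = if m = n then (r:ℂ) ^ (2 * n) else 0 := by
  have main : ∀ k n : ℕ, circleAverage (fun z => z ^ (n + k) * conj (z ^ n)) 0 r
      = if k = 0 then (r:ℂ) ^ (2 * n) else 0 := by
    intro k n
    have e : circleAverage (fun z => z ^ (n + k) * conj (z ^ n)) 0 r
        = circleAverage (fun z : ℂ => (r:ℂ) ^ (2 * n) * z ^ k) 0 r := by
      apply circleAverage_congr_sphere
      intro z hz
      have hz' : z * conj z = (r:ℂ) ^ 2 := by
        rw [Complex.mul_conj, Complex.normSq_eq_norm_sq]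
        simp at hz
        simp [hz, abs_of_nonneg h0]
      simp only [map_pow]
      rw [pow_mul, ← hz']
      ring
    rw [e, hp_mean (by fun_prop) h0 h1]
    rcases eq_or_ne k 0 with rfl | hk <;> simp [*]
  rcases le_total n m with h | h
  · obtain ⟨k, rfl⟩ := Nat.exists_eq_add_of_le h
    rw [main]; simp
  · obtain ⟨k, rfl⟩ := Nat.exists_eq_add_of_le h
    have e : (fun z : ℂ => z ^ m * conj (z ^ (m + k)))
        = fun z => conj (z ^ (m + k) * conj (z ^ m)) := by
      ext z; simp [mul_comm]
    rw [e, hp_conj (by fun_prop) h0 h1, main]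
    rcases eq_or_ne k 0 with rfl | hk <;> simp [*]

lemma hp_parseval {F G : ℂ → ℂ} {a b : ℕ → ℂ}
    (ha : ∀ z ∈ ball (0:ℂ) 1, HasSum (fun n => a n * z ^ n) (F z))
    (hb : ∀ z ∈ ball (0:ℂ) 1, HasSum (fun n => b n * z ^ n) (G z))
    (hG : ContinuousOn G (ball 0 1)) {r : ℝ} (h0 : 0 ≤ r) (h1 : r < 1) :
    HasSum (fun n => a n * conj (b n) * (r:ℂ) ^ (2 * n))
      (circleAverage (fun z => F z * conj (G z)) 0 r) := by
  have hGc : ContinuousOn (fun z => conj (G z)) (ball 0 1) := by fun_prop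
  convert hp_sum ha hGc h0 h1 using 2 with n
  rw [mul_assoc]
  congr 1
  have e : (fun z : ℂ => z ^ n * conj (G z)) = fun z => conj (G z * conj (z ^ n)) := by
    ext z; simp [mul_comm]
  rw [e, hp_conj (by fun_prop) h0 h1]
  have h2 := hp_sum (K := fun z => conj (z ^ n)) hb (by fun_prop) h0 h1
  simp_rw [hp_orth h0 h1] at h2
  have h3 := h2.unique (hasSum_single n (by intro m hm; simp [hm]))
  rw [h3]
  simp

lemma hp_norm_le {K : ℂ → ℂ} {C : ℝ} (hK : ∀ z ∈ ball (0:ℂ) 1, ‖K z‖ ≤ C) {r : ℝ} (h0 : 0 ≤ r)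
    (h1 : r < 1) : ‖circleAverage K 0 r‖ ≤ C := by
  rw [circleAverage_def, norm_smul]
  have := intervalIntegral.norm_integral_le_of_norm_le_const (a := 0) (b := 2 * π)
    (f := fun t => K (circleMap 0 r t)) (C := C) (fun t _ => hK _ (hp_mem h0 h1 t))
  have hpi := Real.two_pi_pos
  rw [sub_zero, abs_of_pos hpi] at this
  rw [Real.norm_of_nonneg (by positivity)]
  rw [inv_mul_le_iff₀ hpi]
  linarith

lemma hp_memlp {F : ℂ → ℂ} {a : ℕ → ℂ} {C : ℝ}
    (ha : ∀ z ∈ ball (0:ℂ) 1, HasSum (fun n => a n * z ^ n) (F z))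
    (hF : ContinuousOn F (ball 0 1)) (hC : ∀ z ∈ ball (0:ℂ) 1, ‖F z‖ ≤ C) :
    Memℓp a 2 := by
  apply memℓp_gen
  simp only [ENNReal.toReal_ofNat, Real.rpow_ofNat]
  apply summable_of_sum_range_le (c := C * C) (fun n => by positivity)
  intro N
  have hlim : Tendsto (fun r : ℝ => ∑ i ∈ Finset.range N, ‖a i‖ ^ 2 * r ^ (2 * i)) (𝓝[<] 1)
      (𝓝 (∑ i ∈ Finset.range N, ‖a i‖ ^ 2)) := by
    have : Continuous (fun r : ℝ => ∑ i ∈ Finset.range N, ‖a i‖ ^ 2 * r ^ (2 * i)) := by fun_prop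
    have := (this.tendsto 1).mono_left (nhdsWithin_le_nhds (s := Set.Iio 1))
    simpa using this
  apply le_of_tendsto hlim
  have hev : ∀ᶠ r : ℝ in 𝓝[<] 1, r ∈ Set.Ioo (0:ℝ) 1 := Ioo_mem_nhdsLT (by norm_num)
  filter_upwards [hev] with r hr
  have hp := hp_parseval ha ha hF hr.1.le hr.2
  have hb : ‖circleAverage (fun z => F z * conj (F z)) 0 r‖ ≤ C * C := by
    apply hp_norm_le _ hr.1.le hr.2
    intro z hz
    have := hC z hz
    rw [norm_mul, RCLike.norm_conj]
    gcongr
    exact (norm_nonneg _).trans this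
  have hre := Complex.hasSum_re hp
  have e : ∀ n, (a n * conj (a n) * (r:ℂ) ^ (2 * n)).re = ‖a n‖ ^ 2 * r ^ (2 * n) := by
    intro n
    rw [Complex.mul_conj, Complex.normSq_eq_norm_sq]
    norm_cast
  simp_rw [e] at hre
  have hr0 := hr.1.le
  calc _ ≤ _ := sum_le_hasSum _ (fun i _ => by positivity) hre
    _ ≤ _ := Complex.re_le_norm _
    _ ≤ _ := hb

lemma hp_inner {F G : ℂ → ℂ} (a b : H2)
    (ha : ∀ z ∈ ball (0:ℂ) 1, HasSum (fun n => a n * z ^ n) (F z))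
    (hb : ∀ z ∈ ball (0:ℂ) 1, HasSum (fun n => b n * z ^ n) (G z))
    (hG : ContinuousOn G (ball 0 1)) :
    Tendsto (fun r => circleAverage (fun z => F z * conj (G z)) 0 r) (𝓝[<] 1)
      (𝓝 (inner ℂ b a)) := by
  have hs := lp.hasSum_inner (𝕜 := ℂ) b a
  have hs' : HasSum (fun n => a n * conj (b n)) (inner ℂ b a) := by
    simpa using hs
  rw [← hs'.tsum_eq]
  have hev : ∀ᶠ r : ℝ in 𝓝[<] 1, r ∈ Set.Ioo (0:ℝ) 1 := Ioo_mem_nhdsLT (by norm_num)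
  have : (fun r : ℝ => circleAverage (fun z => F z * conj (G z)) 0 r) =ᶠ[𝓝[<] 1]
      fun r => ∑' n, a n * conj (b n) * (r:ℂ) ^ (2 * n) := by
    filter_upwards [hev] with r hr
    exact (hp_parseval ha hb hG hr.1.le hr.2).tsum_eq.symm
  rw [tendsto_congr' this]
  apply tendsto_tsum_of_dominated_convergence hs'.summable.norm
  · intro n
    have : Continuous (fun r : ℝ => a n * conj (b n) * (r:ℂ) ^ (2 * n)) := by fun_prop
    have := (this.tendsto 1).mono_left (nhdsWithin_le_nhds (s := Set.Iio 1))
    simpa using this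
  · filter_upwards [hev] with r hr n
    have hr0 := hr.1.le
    rw [norm_mul]
    apply mul_le_of_le_one_right (norm_nonneg _)
    rw [norm_pow]
    apply pow_le_one₀ (norm_nonneg _)
    simpa [abs_of_nonneg hr0] using hr.2.le

lemma hp_lim {Ψ : ℂ → ℂ} {C : ℝ} (hc : ContinuousOn Ψ (ball 0 1))
    (hC : ∀ z ∈ ball (0:ℂ) 1, ‖Ψ z‖ ≤ C)
    (hl : ∀ᵐ θ : ℝ, Tendsto (fun r : ℝ => Ψ ((r : ℂ) * Complex.exp (θ * Complex.I)))
        (𝓝[<] (1:ℝ)) (𝓝 0)) :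
    Tendsto (fun r => circleAverage Ψ 0 r) (𝓝[<] 1) (𝓝 0) := by
  have hev : ∀ᶠ r : ℝ in 𝓝[<] 1, r ∈ Set.Ioo (0:ℝ) 1 := Ioo_mem_nhdsLT (by norm_num)
  have := intervalIntegral.tendsto_integral_filter_of_dominated_convergence (μ := volume)
    (a := 0) (b := 2 * π) (l := 𝓝[<] (1:ℝ)) (F := fun r t => Ψ (circleMap 0 r t))
    (f := fun _ => 0) (fun _ => C)
    (by
      filter_upwards [hev] with r hr
      exact (hp_cont hc hr.1.le hr.2).aestronglyMeasurable)
    (by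
      filter_upwards [hev] with r hr
      filter_upwards with t _
      exact hC _ (hp_mem hr.1.le hr.2 t))
    (by simp)
    (by
      filter_upwards [hl] with t ht _
      simpa [circleMap] using ht)
  have := this.const_smul ((2 * π)⁻¹ : ℝ)
  simpa [circleAverage_def] using this

lemma hp_key {φ : ℂ → ℂ} (hφ : IsInnerFn φ) {P : ℂ → ℂ} (hP : Continuous P)
    (hz : ∀ l : ℂ, ‖l‖ = 1 → P l = 0) :
    Tendsto (fun r => circleAverage (fun z => P (φ z)) 0 r) (𝓝[<] 1) (𝓝 0) := by
  obtain ⟨hd, hb, hl⟩ := hφ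
  obtain ⟨C, hC⟩ := (isCompact_closedBall (0:ℂ) 1).exists_bound_of_continuousOn hP.continuousOn
  apply hp_lim (C := C) (hP.comp_continuousOn hd.continuousOn)
  · intro z hz
    exact hC _ (by simpa using hb z hz)
  · filter_upwards [hl] with θ ⟨l, hl1, hlt⟩
    rw [← hz l hl1]
    exact (hP.tendsto l).comp hlt

lemma hp_eval_hasSum (k : H2) (z : ℂ) (hk : ∀ n, k n = conj (z ^ n)) (f : H2) :
    HasSum (fun n => f n * z ^ n) (inner ℂ k f) := by
  have := lp.hasSum_inner (𝕜 := ℂ) k f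
  simpa [hk] using this

lemma hp_kernel (z : ℂ) (hz : z ∈ ball (0:ℂ) 1) : ∃ k : H2, ∀ n, k n = conj (z ^ n) := by
  have hz' : ‖z‖ < 1 := by simpa using hz
  have : Memℓp (fun n : ℕ => conj (z ^ n)) 2 := by
    apply memℓp_gen
    simp only [ENNReal.toReal_ofNat, Real.rpow_ofNat, RCLike.norm_conj, norm_pow]
    have : (fun n : ℕ => (‖z‖ ^ n) ^ 2) = fun n => (‖z‖ ^ 2) ^ n := by
      ext n; ring
    rw [this]
    apply summable_geometric_of_lt_one (by positivity)
    exact pow_lt_one₀ (norm_nonneg _) hz' (by norm_num)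
  exact ⟨⟨_, this⟩, fun n => rfl⟩

end helpers

/-- For every inner function `φ : 𝔻 → 𝔻` there exists `w ∈ H²` such
that the weighted composition operator `T_{w,φ}` is an isometry on `H²`. -/
theorem exists_weight_isometry_of_inner
    (φ : ℂ → ℂ)
    (hφmaps : Set.MapsTo φ (ball (0:ℂ) 1) (ball (0:ℂ) 1))
    (hφ : IsInnerFn φ) :
    ∃ (w : ℂ → ℂ) (W : H2) (T : H2 →L[ℂ] H2),
      DifferentiableOn ℂ w (ball (0:ℂ) 1) ∧
      (∀ z ∈ ball (0:ℂ) 1, H2.eval W z = w z) ∧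
      (∀ (f : H2), ∀ z ∈ ball (0:ℂ) 1, H2.eval (T f) z = w z * H2.eval f (φ z)) ∧
      ∀ f : H2, ‖T f‖ = ‖f‖ := by
  have hd := hφ.1
  have hdc := hd.continuousOn
  obtain ⟨a, ha⟩ : ∃ a, a = φ 0 := ⟨_, rfl⟩
  have ha1 : ‖a‖ < 1 := by
    have := hφmaps (mem_ball_self (x := (0:ℂ)) one_pos)
    simpa [← ha] using this
  obtain ⟨s, hs0, hs2⟩ : ∃ s : ℝ, s ≠ 0 ∧ s ^ 2 = 1 - ‖a‖ ^ 2 := by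
    have : 0 < 1 - ‖a‖ ^ 2 := by nlinarith [norm_nonneg a]
    exact ⟨√(1 - ‖a‖ ^ 2), (Real.sqrt_pos.2 this).ne', Real.sq_sqrt this.le⟩
  have hsc : (s:ℂ) ≠ 0 := by exact_mod_cast hs0
  have hs2c : (s:ℂ) ^ 2 = 1 - a * (starRingEnd ℂ) a := by
    rw [Complex.mul_conj, Complex.normSq_eq_norm_sq]
    exact_mod_cast hs2
  -- the model functions
  let ω : ℂ → ℂ := fun l => (1 - (starRingEnd ℂ) a * l) / s
  have hωd : Differentiable ℂ ω := by
    intro z; fun_prop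
  have hωc : Continuous ω := hωd.continuous
  let g : ℕ → ℂ → ℂ := fun n z => ω (φ z) * φ z ^ n
  have hgd : ∀ n, DifferentiableOn ℂ (g n) (ball 0 1) := by
    intro n
    exact (hωd.comp_differentiableOn hd).mul (hd.pow n)
  have hex : ∀ n, ∃ e : H2, ∀ z ∈ ball (0:ℂ) 1, HasSum (fun k => e k * z ^ k) (g n z) := by
    intro n
    obtain ⟨c, hc⟩ := hp_exists_coeff (hgd n)
    obtain ⟨C, hC⟩ := (isCompact_closedBall (0:ℂ) 1).exists_bound_of_continuousOn
      (f := fun l => ω l * l ^ n) (by fun_prop)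
    have := hp_memlp (C := C) hc (hgd n).continuousOn (by
      intro z hz
      exact hC _ (by simpa using hφ.2.1 z hz))
    exact ⟨⟨c, this⟩, hc⟩
  choose e he using hex
  have hev : ∀ᶠ r : ℝ in 𝓝[<] 1, r ∈ Set.Ioo (0:ℝ) 1 := Ioo_mem_nhdsLT (by norm_num)
  have hcirc : ∀ l : ℂ, ‖l‖ = 1 → l * (starRingEnd ℂ) l = 1 := by
    intro l hl
    rw [Complex.mul_conj, Complex.normSq_eq_norm_sq, hl]; simp
  -- general computation of inner products
  have hin : ∀ m n (Q : ℂ → ℂ) (v : ℂ), Continuous Q →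
      (∀ l : ℂ, ‖l‖ = 1 → ω l * l ^ m * (starRingEnd ℂ) (ω l * l ^ n) = Q l) →
      (∀ r ∈ Set.Ioo (0:ℝ) 1, Real.circleAverage (fun z => Q (φ z)) 0 r = v) →
      inner ℂ (e n) (e m) = v := by
    intro m n Q v hQ hQl hav
    have h1 := hp_inner (e m) (e n) (he m) (he n) (hgd n).continuousOn
    have h2 := hp_key hφ
      (P := fun l => ω l * l ^ m * (starRingEnd ℂ) (ω l * l ^ n) - Q l) (by fun_prop)
      (fun l hl => by rw [hQl l hl, sub_self])
    have h3 : Tendsto (fun r => Real.circleAverage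
        (fun z => g m z * (starRingEnd ℂ) (g n z)) 0 r) (𝓝[<] 1) (𝓝 v) := by
      have h4 := h2.add_const v
      rw [zero_add] at h4
      refine h4.congr' ?_
      filter_upwards [hev] with r hr
      rw [Real.circleAverage_fun_sub, hav r hr, sub_add_cancel]
      · refine hp_ci ?_ hr.1.le hr.2
        exact ((hgd m).continuousOn.mul
          (Complex.continuous_conj.comp_continuousOn (hgd n).continuousOn))
      · exact hp_ci (hQ.comp_continuousOn hdc) hr.1.le hr.2
    exact tendsto_nhds_unique h1 h3
  have hdiag : ∀ n, inner ℂ (e n) (e n) = (1:ℂ) := by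
    intro n
    apply hin n n (fun l => (1 / s) * ω l - (starRingEnd ℂ) ((starRingEnd ℂ) a / s ^ 2 * (l - a)))
    · fun_prop
    · intro l hl
      have h := hcirc l hl
      have h' : l ^ n * (starRingEnd ℂ) l ^ n = 1 := by rw [← mul_pow, h, one_pow]
      simp only [ω, map_mul, map_div₀, map_sub, map_one, map_pow, Complex.conj_ofReal,
        Complex.conj_conj]
      field_simp
      linear_combination (1 - (starRingEnd ℂ) a * l) * (1 - a * (starRingEnd ℂ) l) * h'
        + a * (starRingEnd ℂ) a * h
    · intro r hr
      have d1 : DifferentiableOn ℂ (fun z => (1 / s) * ω (φ z)) (ball 0 1) :=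
        (hωd.comp_differentiableOn hd).const_mul _
      have d2 : DifferentiableOn ℂ (fun z => (starRingEnd ℂ) a / s ^ 2 * (φ z - a)) (ball 0 1) :=
        (hd.sub_const a).const_mul _
      rw [Real.circleAverage_fun_sub, hp_conj d2.continuousOn hr.1.le hr.2,
        hp_mean d1 hr.1.le hr.2, hp_mean d2 hr.1.le hr.2, ← ha]
      · simp only [ω, sub_self, mul_zero, map_zero, sub_zero]
        field_simp
        rw [hs2c]; ring
      · exact hp_ci d1.continuousOn hr.1.le hr.2
      · exact hp_ci (Complex.continuous_conj.comp_continuousOn d2.continuousOn) hr.1.le hr.2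
  have hoff : ∀ n k, inner ℂ (e n) (e (n + (k + 1))) = (0:ℂ) := by
    intro n k
    apply hin (n + (k + 1)) n (fun l => ω l * l ^ k * ((l - a) / s))
    · fun_prop
    · intro l hl
      have h := hcirc l hl
      have h' : l ^ n * (starRingEnd ℂ) l ^ n = 1 := by rw [← mul_pow, h, one_pow]
      simp only [ω, map_mul, map_div₀, map_sub, map_one, map_pow, Complex.conj_ofReal,
        Complex.conj_conj]
      field_simp
      rw [pow_add, pow_succ]
      linear_combination (1 - (starRingEnd ℂ) a * l) * l ^ k * l * (1 - a * (starRingEnd ℂ) l) * h'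
        - (1 - (starRingEnd ℂ) a * l) * l ^ k * a * h
    · intro r hr
      have d1 : DifferentiableOn ℂ (fun z => ω (φ z) * φ z ^ k * ((φ z - a) / s)) (ball 0 1) :=
        ((hωd.comp_differentiableOn hd).mul (hd.pow k)).mul ((hd.sub_const a).div_const _)
      rw [hp_mean d1 hr.1.le hr.2, ← ha]
      simp
  have horth : Orthonormal ℂ e := by
    rw [orthonormal_iff_ite]
    intro i j
    rcases lt_trichotomy i j with h | h | h
    · obtain ⟨k, rfl⟩ := Nat.exists_eq_add_of_lt h
      rw [if_neg (by omega)]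
      exact hoff i k
    · subst h
      simpa using hdiag i
    · obtain ⟨k, rfl⟩ := Nat.exists_eq_add_of_lt h
      rw [if_neg (by omega), ← inner_conj_symm]
      rw [show j + k + 1 = j + (k + 1) by ring, hoff j k, map_zero]
  refine ⟨fun z => ω (φ z), e 0, horth.orthogonalFamily.linearIsometry.toContinuousLinearMap,
    hωd.comp_differentiableOn hd, ?_, ?_, ?_⟩
  · intro z hz
    simpa [g, H2.eval] using (he 0 z hz).tsum_eq
  · intro f z hz
    obtain ⟨k, hk⟩ := hp_kernel z hz
    obtain ⟨k', hk'⟩ := hp_kernel (φ z) (hφmaps hz)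
    have h1 := horth.orthogonalFamily.hasSum_linearIsometry f
    have h2 := h1.mapL (innerSL ℂ k)
    have h3 := (hp_eval_hasSum k' (φ z) hk' f).mul_left (ω (φ z))
    have h4 : ∀ n, inner ℂ k (e n) = g n z := fun n =>
      (hp_eval_hasSum k z hk (e n)).unique (he n z hz)
    have h5 := hp_eval_hasSum k z hk (horth.orthogonalFamily.linearIsometry f)
    unfold H2.eval
    rw [(hp_eval_hasSum k' (φ z) hk' f).tsum_eq]
    refine h5.tsum_eq.trans ?_
    refine h2.unique ?_
    refine hp_congr (fun n => ?_) h3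
    simp [inner_smul_right, h4, g]
    ring
  · intro f
    exact horth.orthogonalFamily.linearIsometry.norm_map f
end

section
/- Let φ be an inner function with a zero at β ∈ 𝔻 (i.e. φ(β) = 0), let θ be any inner function, let k_β(z) = 1/(1 − β̄z) be the reproducing kernel of H² at β, and set w = θ·k_β/‖k_β‖₂. Then the weighted composition operator T_{w,φ} is an isometry on the Hardy space H². -/
open Complex Metric Filter Topology MeasureTheory

section helpers

instance fact_two_pi : Fact (0 < 2 * Real.pi) := ⟨by positivity⟩

abbrev C2 := AddCircle (2 * Real.pi)

lemma my_hasSum_congr {f g : ℕ → ℂ} {s : ℂ} (h : ∀ n, f n = g n) : HasSum f s ↔ HasSum g s := by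
  rw [funext h]

structure HasBd (g : ℂ → ℂ) (gs : C2 → ℂ) : Prop where
  diff : DifferentiableOn ℂ g (ball (0:ℂ) 1)
  bdd : ∃ C : ℝ, ∀ z ∈ ball (0:ℂ) 1, ‖g z‖ ≤ C
  lim : ∀ᵐ t ∂(AddCircle.haarAddCircle : Measure C2),
    Tendsto (fun r : ℝ => g ((r : ℂ) * (AddCircle.toCircle t : ℂ))) (𝓝[<] (1:ℝ)) (𝓝 (gs t))

lemma HasBd.mul {g h : ℂ → ℂ} {gs hs : C2 → ℂ} (hg : HasBd g gs) (hh : HasBd h hs) :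
    HasBd (fun z => g z * h z) (fun t => gs t * hs t) := by
  refine ⟨hg.diff.mul hh.diff, ?_, ?_⟩
  · obtain ⟨C, hC⟩ := hg.bdd
    obtain ⟨D, hD⟩ := hh.bdd
    refine ⟨C * D, fun z hz => ?_⟩
    rw [norm_mul]
    exact mul_le_mul (hC z hz) (hD z hz) (norm_nonneg _) ((norm_nonneg _).trans (hC z hz))
  · filter_upwards [hg.lim, hh.lim] with t h1 h2
    exact h1.mul h2

lemma HasBd.one : HasBd (fun _ => 1) (fun _ => 1) :=
  ⟨differentiableOn_const _, ⟨1, by simp⟩, by simp⟩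

lemma HasBd.const (c : ℂ) : HasBd (fun _ => c) (fun _ => c) :=
  ⟨differentiableOn_const _, ⟨‖c‖, by simp⟩, by simp⟩

lemma HasBd.pow {g : ℂ → ℂ} {gs : C2 → ℂ} (hg : HasBd g gs) (n : ℕ) :
    HasBd (fun z => g z ^ n) (fun t => gs t ^ n) := by
  induction n with
  | zero => simpa using HasBd.one
  | succ n ih => simpa [pow_succ] using ih.mul hg

lemma mem_ball_circle {r : ℝ} (h0 : 0 ≤ r) (h1 : r < 1) (t : C2) :
    (r : ℂ) * (AddCircle.toCircle t : ℂ) ∈ ball (0:ℂ) 1 := by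
  rw [mem_ball_zero_iff, norm_mul, Circle.norm_coe, mul_one]
  simpa [abs_of_nonneg h0] using h1

lemma cont_circle {g : ℂ → ℂ} (hg : DifferentiableOn ℂ g (ball (0:ℂ) 1)) {r : ℝ} (h0 : 0 ≤ r)
    (h1 : r < 1) : Continuous (fun t : C2 => g ((r : ℂ) * (AddCircle.toCircle t : ℂ))) := by
  refine hg.continuousOn.comp_continuous ?_ (mem_ball_circle h0 h1)
  exact continuous_const.mul (continuous_subtype_val.comp AddCircle.continuous_toCircle)

lemma coeff_r {g : ℂ → ℂ} {a : ℕ → ℂ}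
    (ha : ∀ z ∈ ball (0:ℂ) 1, HasSum (fun n => a n * z ^ n) (g z))
    {r : ℝ} (h0 : 0 ≤ r) (h1 : r < 1) (m : ℤ) :
    fourierCoeff (fun t : C2 => g ((r : ℂ) * (AddCircle.toCircle t : ℂ))) m =
      if 0 ≤ m then a m.toNat * (r:ℂ) ^ m.toNat else 0 := by
  have hs : Summable (fun n => ‖a n * (r:ℂ) ^ n‖) := by
    have := (ha (r:ℂ) (by simp [abs_of_nonneg h0, h1])).summable
    exact this.norm
  let F : ℕ → C2 → ℂ := fun n t => fourier (-m) t * ((a n * (r:ℂ)^n) * fourier (n:ℤ) t)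
  have hF : ∀ n t, ‖F n t‖ = ‖a n * (r:ℂ) ^ n‖ := by
    intro n t
    simp only [F, norm_mul, fourier_apply, Circle.norm_coe, one_mul, mul_one]
  have hFi : ∀ n, Integrable (F n) (AddCircle.haarAddCircle : Measure C2) := by
    intro n
    have : Continuous (F n) := by fun_prop
    exact this.integrable_of_hasCompactSupport (HasCompactSupport.of_compactSpace _)
  have key := hasSum_integral_of_summable_integral_norm hFi (by simpa [hF] using hs)
  have e1 : ∀ t, ∑' n, F n t = fourier (-m) t • g ((r : ℂ) * (AddCircle.toCircle t : ℂ)) := by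
    intro t
    have := (ha _ (mem_ball_circle h0 h1 t)).mul_left (fourier (-m) t)
    rw [smul_eq_mul, ← this.tsum_eq]
    congr 1
    ext n
    simp only [F, fourier_apply, mul_pow]
    rw [natCast_zsmul, AddCircle.toCircle_nsmul]
    push_cast
    ring
  simp only [e1] at key
  have e2 : ∀ n, ∫ t, F n t ∂(AddCircle.haarAddCircle : Measure C2) =
      if (n:ℤ) = m then a n * (r:ℂ)^n else 0 := by
    intro n
    have h := congrFun (fourierCoeff_fourier (T := 2 * Real.pi) (n:ℤ)) m
    have h' : ∫ t, F n t ∂(AddCircle.haarAddCircle : Measure C2) =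
      (a n * (r:ℂ)^n) * fourierCoeff (fourier (T := 2 * Real.pi) (n:ℤ)) m := by
      rw [fourierCoeff, ← integral_const_mul]
      congr 1
      ext t
      simp only [F, smul_eq_mul]
      ring
    rw [h', h, Pi.single_apply]
    by_cases hh : (n:ℤ) = m
    · simp [hh]
    · simp [hh, Ne.symm hh]
  simp only [e2] at key
  refine key.unique ?_
  split_ifs with hm
  · obtain ⟨k, rfl⟩ := Int.eq_ofNat_of_zero_le hm
    simp only [Int.toNat_natCast]
    refine (my_hasSum_congr fun n => ?_).2 (hasSum_ite_eq k (a k * (r:ℂ)^k))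
    by_cases h : n = k
    · simp [h]
    · simp [h]
  · refine (my_hasSum_congr fun n => ?_).2 (hasSum_zero : HasSum (fun _ : ℕ => (0:ℂ)) 0)
    rw [if_neg]
    omega

lemma exists_seq : ∃ u : ℕ → ℝ, (∀ n, 0 ≤ u n) ∧ (∀ n, u n < 1) ∧ Tendsto u atTop (𝓝[<] (1:ℝ)) := by
  obtain ⟨u, -, hu, hl⟩ := exists_seq_strictMono_tendsto' (show (0:ℝ) < 1 by norm_num)
  exact ⟨u, fun n => (hu n).1.le, fun n => (hu n).2, tendsto_nhdsWithin_iff.2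
    ⟨hl, Eventually.of_forall fun n => (hu n).2⟩⟩

lemma HasBd.meas {g : ℂ → ℂ} {gs : C2 → ℂ} (hg : HasBd g gs) :
    AEStronglyMeasurable gs (AddCircle.haarAddCircle : Measure C2) := by
  obtain ⟨u, u0, u1, ul⟩ := exists_seq
  refine aestronglyMeasurable_of_tendsto_ae atTop
    (f := fun n t => g ((u n : ℂ) * (AddCircle.toCircle t : ℂ)))
    (fun n => (cont_circle hg.diff (u0 n) (u1 n)).aestronglyMeasurable) ?_
  filter_upwards [hg.lim] with t ht
  exact ht.comp ul

lemma HasBd.memLp {g : ℂ → ℂ} {gs : C2 → ℂ} (hg : HasBd g gs) :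
    MemLp gs 2 (AddCircle.haarAddCircle : Measure C2) := by
  obtain ⟨C, hC⟩ := hg.bdd
  refine MemLp.of_bound hg.meas C ?_
  obtain ⟨u, u0, u1, ul⟩ := exists_seq
  filter_upwards [hg.lim] with t ht
  exact le_of_tendsto (ht.comp ul).norm
    (Eventually.of_forall fun n => hC _ (mem_ball_circle (u0 n) (u1 n) t))

lemma HasBd.coeff {g : ℂ → ℂ} {gs : C2 → ℂ} (hg : HasBd g gs) {a : ℕ → ℂ}
    (ha : ∀ z ∈ ball (0:ℂ) 1, HasSum (fun n => a n * z ^ n) (g z)) (m : ℤ) :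
    fourierCoeff gs m = if 0 ≤ m then a m.toNat else 0 := by
  obtain ⟨u, u0, u1, ul⟩ := exists_seq
  obtain ⟨C, hC⟩ := hg.bdd
  have h1 : Tendsto (fun n => fourierCoeff
      (fun t : C2 => g ((u n : ℂ) * (AddCircle.toCircle t : ℂ))) m) atTop
      (𝓝 (fourierCoeff gs m)) := by
    refine tendsto_integral_of_dominated_convergence (fun _ => C) ?_ (integrable_const _) ?_ ?_
    · intro n
      exact ((fourier (-m)).continuous.smul
        (cont_circle hg.diff (u0 n) (u1 n))).aestronglyMeasurable
    · intro n
      refine Eventually.of_forall fun t => ?_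
      rw [norm_smul, fourier_apply, Circle.norm_coe, one_mul]
      exact hC _ (mem_ball_circle (u0 n) (u1 n) t)
    · filter_upwards [hg.lim] with t ht
      exact (ht.comp ul).const_smul _
  refine tendsto_nhds_unique h1 ?_
  simp only [coeff_r ha (u0 _) (u1 _)]
  split_ifs
  · have hu : Tendsto (fun n => ((u n : ℝ) : ℂ)) atTop (𝓝 1) := by
      have := (Complex.continuous_ofReal.tendsto 1).comp (ul.mono_right nhdsWithin_le_nhds)
      simpa [Function.comp_def] using this
    simpa using (hu.pow m.toNat).const_mul (a m.toNat)
  · exact tendsto_const_nhds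

lemma hasSum_nat {F : ℤ → ℂ} {s : ℂ} (h : HasSum F s) (h0 : ∀ m, ¬ 0 ≤ m → F m = 0) :
    HasSum (fun n : ℕ => F n) s := by
  refine (Function.Injective.hasSum_iff (f := F) Nat.cast_injective ?_).2 h
  intro x hx
  apply h0
  intro h
  obtain ⟨k, rfl⟩ := Int.eq_ofNat_of_zero_le h
  exact hx ⟨k, rfl⟩

lemma HasBd.hasSum_inner {g h : ℂ → ℂ} {gs hs : C2 → ℂ} (hg : HasBd g gs) (hh : HasBd h hs)
    {a b : ℕ → ℂ}
    (ha : ∀ z ∈ ball (0:ℂ) 1, HasSum (fun n => a n * z ^ n) (g z))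
    (hb : ∀ z ∈ ball (0:ℂ) 1, HasSum (fun n => b n * z ^ n) (h z)) :
    HasSum (fun n => inner ℂ (a n) (b n))
      (∫ t, inner ℂ (gs t) (hs t) ∂(AddCircle.haarAddCircle : Measure C2)) := by
  let G := hg.memLp.toLp gs
  let H := hh.memLp.toLp hs
  have key := fourierBasis.hasSum_inner_mul_inner G H
  have hG : ∀ m, inner ℂ (fourierBasis m) G = if 0 ≤ m then a m.toNat else 0 := by
    intro m
    rw [← fourierBasis.repr_apply_apply, fourierBasis_repr, ← hg.coeff ha]
    exact congrFun (fourierCoeff_congr_ae hg.memLp.coeFn_toLp) m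
  have hH : ∀ m, inner ℂ (fourierBasis m) H = if 0 ≤ m then b m.toNat else 0 := by
    intro m
    rw [← fourierBasis.repr_apply_apply, fourierBasis_repr, ← hh.coeff hb]
    exact congrFun (fourierCoeff_congr_ae hh.memLp.coeFn_toLp) m
  have e : inner ℂ G H = ∫ t, inner ℂ (gs t) (hs t) ∂(AddCircle.haarAddCircle : Measure C2) := by
    rw [L2.inner_def]
    refine integral_congr_ae ?_
    filter_upwards [hg.memLp.coeFn_toLp, hh.memLp.coeFn_toLp] with t h1 h2
    rw [h1, h2]
  rw [e] at key
  have k2 := hasSum_nat key (fun m hm => by rw [hH, if_neg hm, mul_zero])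
  refine (my_hasSum_congr fun n => ?_).2 k2
  rw [hH, ← inner_conj_symm G, hG]
  simp [mul_comm]

lemma HasBd.exists_H2 {g : ℂ → ℂ} {gs : C2 → ℂ} (hg : HasBd g gs) :
    ∃ G : H2, ∀ z ∈ ball (0:ℂ) 1, HasSum (fun n => G n * z ^ n) (g z) := by
  let a : ℕ → ℂ := fun n => (n.factorial : ℂ)⁻¹ * iteratedDeriv n g 0
  have ha : ∀ z ∈ ball (0:ℂ) 1, HasSum (fun n => a n * z ^ n) (g z) := by
    intro z hz
    have := Complex.hasSum_taylorSeries_on_ball hg.diff hz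
    refine (my_hasSum_congr fun n => ?_).2 this
    simp [a]
    ring
  have hs := (hg.hasSum_inner hg ha ha).summable
  have hm : Memℓp a 2 := by
    refine memℓp_gen ?_
    have := hs.norm
    refine (summable_congr fun n => ?_).2 this
    simp [sq]
  exact ⟨⟨a, hm⟩, ha⟩

lemma kern_mem {z : ℂ} (hz : z ∈ ball (0:ℂ) 1) :
    Memℓp (fun n : ℕ => (starRingEnd ℂ z) ^ n) 2 := by
  refine memℓp_gen ?_
  have hz' : ‖z‖ < 1 := by simpa using hz
  have : Summable (fun n : ℕ => (‖z‖ ^ 2) ^ n) :=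
    summable_geometric_of_lt_one (by positivity) (by nlinarith [norm_nonneg z])
  refine (summable_congr fun n => ?_).2 this
  simp [← pow_mul, mul_comm]

noncomputable def kern (z : ℂ) (hz : z ∈ ball (0:ℂ) 1) : H2 := ⟨_, kern_mem hz⟩

lemma hasSum_kern {z : ℂ} (hz : z ∈ ball (0:ℂ) 1) (f : H2) :
    HasSum (fun n => f n * z ^ n) (inner ℂ (kern z hz) f) := by
  refine (my_hasSum_congr fun n => ?_).2 (lp.hasSum_inner (𝕜 := ℂ) (kern z hz) f)
  simp [kern]

lemma eval_eq {z : ℂ} (hz : z ∈ ball (0:ℂ) 1) (f : H2) :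
    H2.eval f z = inner ℂ (kern z hz) f := (hasSum_kern hz f).tsum_eq

lemma hasSum_eval {z : ℂ} (hz : z ∈ ball (0:ℂ) 1) (f : H2) :
    HasSum (fun n => f n * z ^ n) (H2.eval f z) := by
  rw [eval_eq hz]; exact hasSum_kern hz f

lemma IsInnerFn.hasBd {φ : ℂ → ℂ} (hφ : IsInnerFn φ) :
    ∃ φs : C2 → ℂ, HasBd φ φs ∧ ∀ᵐ t ∂(AddCircle.haarAddCircle : Measure C2), ‖φs t‖ = 1 := by
  have hae : ∀ᵐ t ∂(AddCircle.haarAddCircle : Measure C2), ∃ l : ℂ, ‖l‖ = 1 ∧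
      Tendsto (fun r : ℝ => φ ((r : ℂ) * (AddCircle.toCircle t : ℂ))) (𝓝[<] (1:ℝ)) (𝓝 l) := by
    have hv : ∀ᵐ t ∂(volume : Measure C2), ∃ l : ℂ, ‖l‖ = 1 ∧
      Tendsto (fun r : ℝ => φ ((r : ℂ) * (AddCircle.toCircle t : ℂ))) (𝓝[<] (1:ℝ)) (𝓝 l) := by
      have hq := (AddCircle.measurePreserving_equivIoc (2 * Real.pi) (a := 0)).quasiMeasurePreserving
      have h2 := (measurePreserving_subtype_coe (μa := (volume : Measure ℝ))
        (measurableSet_Ioc (a := (0:ℝ)) (b := 0 + 2 * Real.pi))).quasiMeasurePreserving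
      have h3 := (h2.comp hq).ae (ae_restrict_of_ae hφ.2.2)
      filter_upwards [h3] with t ht
      convert ht using 7
      have : ((AddCircle.equivIoc (2 * Real.pi) 0 t : ℝ) : C2) = t :=
        (AddCircle.equivIoc (2 * Real.pi) 0).symm_apply_apply t
      conv_lhs => rw [← this]
      rw [AddCircle.toCircle_apply_mk]
      simp [Circle.coe_exp]
    rw [AddCircle.volume_eq_smul_haarAddCircle] at hv
    rwa [Measure.ae_ennreal_smul_measure_eq (by simp [Real.pi_pos])] at hv
  have hch : ∀ t : C2, ∃ l : ℂ, (∃ l : ℂ, ‖l‖ = 1 ∧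
      Tendsto (fun r : ℝ => φ ((r : ℂ) * (AddCircle.toCircle t : ℂ))) (𝓝[<] (1:ℝ)) (𝓝 l)) →
      ‖l‖ = 1 ∧
      Tendsto (fun r : ℝ => φ ((r : ℂ) * (AddCircle.toCircle t : ℂ))) (𝓝[<] (1:ℝ)) (𝓝 l) := by
    intro t
    by_cases h : ∃ l : ℂ, ‖l‖ = 1 ∧
      Tendsto (fun r : ℝ => φ ((r : ℂ) * (AddCircle.toCircle t : ℂ))) (𝓝[<] (1:ℝ)) (𝓝 l)
    · obtain ⟨l, hl⟩ := h
      exact ⟨l, fun _ => hl⟩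
    · exact ⟨0, fun h' => absurd h' h⟩
  choose φs hφs using hch
  refine ⟨φs, ⟨hφ.1, ⟨1, hφ.2.1⟩, ?_⟩, ?_⟩
  · filter_upwards [hae] with t ht using (hφs t ht).2
  · filter_upwards [hae] with t ht using (hφs t ht).1

lemma kern_ne {β z : ℂ} (hβ : β ∈ ball (0:ℂ) 1) (hz : ‖z‖ ≤ 1) :
    1 - ‖β‖ ≤ ‖1 - (starRingEnd ℂ) β * z‖ := by
  have h1 : ‖(starRingEnd ℂ) β * z‖ ≤ ‖β‖ := by
    rw [norm_mul, RCLike.norm_conj]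
    exact mul_le_of_le_one_right (norm_nonneg _) hz
  have := norm_sub_norm_le (1:ℂ) ((starRingEnd ℂ) β * z)
  rw [norm_one] at this
  linarith

lemma kern_hasBd {β : ℂ} (hβ : β ∈ ball (0:ℂ) 1) :
    HasBd (fun z => (1 - (starRingEnd ℂ) β * z)⁻¹)
      (fun t => (1 - (starRingEnd ℂ) β * (AddCircle.toCircle t : ℂ))⁻¹) := by
  have hb : 0 < 1 - ‖β‖ := by
    have : ‖β‖ < 1 := by simpa using hβ
    linarith
  have hne : ∀ z : ℂ, ‖z‖ ≤ 1 → 1 - (starRingEnd ℂ) β * z ≠ 0 := by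
    intro z hz h
    have := kern_ne hβ hz
    rw [h, norm_zero] at this
    linarith
  refine ⟨?_, ⟨(1 - ‖β‖)⁻¹, ?_⟩, ?_⟩
  · intro z hz
    have hz' : ‖z‖ < 1 := by simpa using hz
    have : DifferentiableAt ℂ (fun z => 1 - (starRingEnd ℂ) β * z) z := by fun_prop
    exact (this.inv (hne z hz'.le)).differentiableWithinAt
  · intro z hz
    have hz' : ‖z‖ < 1 := by simpa using hz
    rw [norm_inv]
    exact inv_anti₀ hb (kern_ne hβ hz'.le)
  · refine Eventually.of_forall fun t => ?_
    refine Tendsto.inv₀ ?_ (hne _ (Circle.norm_coe _).le)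
    have : Continuous (fun r : ℝ => 1 - (starRingEnd ℂ) β * ((r:ℂ) * (AddCircle.toCircle t : ℂ))) := by
      fun_prop
    have := (this.tendsto 1).mono_left (nhdsWithin_le_nhds (s := Set.Iio 1))
    simpa using this

end helpers

/-- Let `φ` be an inner function with a zero at `β ∈ 𝔻`, let `θ` be any
inner function, let `k_β(z) = 1/(1 − β̄z)` be the reproducing kernel of `H²` at `β`
(represented by `K : H²`), and set `w = θ·k_β/‖k_β‖₂`.  Then the weighted composition
operator `T_{w,φ}` is an isometry on `H²`. -/
theorem isometry_of_kernel_weight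
    (φ θ : ℂ → ℂ)
    (hφmaps : Set.MapsTo φ (ball (0:ℂ) 1) (ball (0:ℂ) 1))
    (hφ : IsInnerFn φ) (hθ : IsInnerFn θ)
    (β : ℂ) (hβ : β ∈ ball (0:ℂ) 1) (hφβ : φ β = 0)
    (K : H2) (hK : ∀ z ∈ ball (0:ℂ) 1, H2.eval K z = (1 - (starRingEnd ℂ) β * z)⁻¹)
    (w : ℂ → ℂ)
    (hwdef : ∀ z ∈ ball (0:ℂ) 1, w z = θ z * (1 - (starRingEnd ℂ) β * z)⁻¹ / (‖K‖ : ℂ)) :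
    ∃ T : H2 →L[ℂ] H2,
      (∀ (f : H2), ∀ z ∈ ball (0:ℂ) 1, H2.eval (T f) z = w z * H2.eval f (φ z)) ∧
      ∀ f : H2, ‖T f‖ = ‖f‖ := by

  obtain ⟨φs, bφ, nφ⟩ := hφ.hasBd
  obtain ⟨θs, bθ, nθ⟩ := hθ.hasBd
  have bk := kern_hasBd hβ
  set ks : C2 → ℂ := fun t => (1 - (starRingEnd ℂ) β * (AddCircle.toCircle t : ℂ))⁻¹ with hks
  set k : ℂ → ℂ := fun z => (1 - (starRingEnd ℂ) β * z)⁻¹ with hk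
  have hKs : ∀ z ∈ ball (0:ℂ) 1, HasSum (fun n => K n * z ^ n) (k z) := by
    intro z hz
    have := hasSum_eval hz K
    rwa [hK z hz] at this
  have hK0 : ‖K‖ ≠ 0 := by
    intro h
    have h' : K = 0 := norm_eq_zero.1 h
    have := hK 0 (by simp)
    rw [eval_eq (by simp), h', inner_zero_right] at this
    simp at this
  have hKc : (‖K‖ : ℂ) ≠ 0 := by exact_mod_cast hK0
  have be : ∀ n : ℕ, HasBd (fun z => (θ z * k z * (‖K‖ : ℂ)⁻¹) * φ z ^ n)
      (fun t => (θs t * ks t * (‖K‖ : ℂ)⁻¹) * φs t ^ n) :=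
    fun n => ((bθ.mul bk).mul (HasBd.const _)).mul (bφ.pow n)
  choose e he using fun n => (be n).exists_H2
  choose G hG using fun n => (bk.mul (bφ.pow n)).exists_H2
  have hKcoef : ∀ n, K n = (starRingEnd ℂ β) ^ n := by
    intro n
    have h1 := bk.coeff hKs n
    have h2 := bk.coeff (a := fun n => (starRingEnd ℂ β) ^ n) (by
      intro z hz
      have hz' : ‖z‖ < 1 := by simpa using hz
      have hb : ‖β‖ < 1 := by simpa using hβ
      have := hasSum_geometric_of_norm_lt_one (ξ := starRingEnd ℂ β * z) (by
        rw [norm_mul, RCLike.norm_conj]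
        nlinarith [norm_nonneg z, norm_nonneg β])
      simpa [mul_pow] using this) n
    rw [h1] at h2
    simpa using h2
  have hKk : K = kern β hβ := by
    ext n
    rw [hKcoef]; rfl
  have hKG : ∀ n, inner ℂ K (G n) = k β * φ β ^ n := by
    intro n
    rw [hKk, ← eval_eq]
    exact (hasSum_eval hβ _).unique (hG n β hβ)
  have hin : ∀ n m, inner ℂ (e n) (e (n + m)) = ((‖K‖ : ℂ)⁻¹)^2 * (k β * φ β ^ m) := by
    intro n m
    rw [← hKG]
    have i1 := (lp.hasSum_inner (𝕜 := ℂ) (e n) (e (n+m))).unique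
      ((be n).hasSum_inner (be (n+m)) (he n) (he (n+m)))
    have i2 := (lp.hasSum_inner (𝕜 := ℂ) K (G m)).unique
      (bk.hasSum_inner (bk.mul (bφ.pow m)) hKs (hG m))
    rw [i1, i2, ← integral_const_mul]
    refine integral_congr_ae ?_
    filter_upwards [nφ, nθ] with t h1 h2
    have h1' : φs t * starRingEnd ℂ (φs t) = 1 := by rw [Complex.mul_conj']; simp [h1]
    have h2' : θs t * starRingEnd ℂ (θs t) = 1 := by rw [Complex.mul_conj']; simp [h2]
    have h3' : φs t ^ n * starRingEnd ℂ (φs t) ^ n = 1 := by rw [← mul_pow, h1', one_pow]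
    simp only [RCLike.inner_apply, map_mul, map_pow, map_inv₀, Complex.conj_ofReal, pow_add]
    linear_combination (ks t * starRingEnd ℂ (ks t) * (‖K‖ : ℂ)⁻¹ ^ 2 * φs t ^ m) *
      (φs t ^ n * starRingEnd ℂ (φs t) ^ n * h2' + h3')
  have hkβ : k β = (‖K‖ : ℂ)^2 := by
    have := inner_self_eq_norm_sq_to_K (𝕜 := ℂ) K
    have h2 : k β = H2.eval K β := (hK β hβ).symm
    rw [h2, eval_eq hβ, ← hKk, this]
    rfl
  have hon : Orthonormal ℂ e := by
    have h1 : ∀ n, inner ℂ (e n) (e n) = 1 := by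
      intro n
      have := hin n 0
      rw [add_zero, hkβ, pow_zero, mul_one, ← mul_pow, inv_mul_cancel₀ hKc, one_pow] at this
      exact this
    have h2 : ∀ n m, n < m → inner ℂ (e n) (e m) = 0 := by
      intro n m hnm
      obtain ⟨d, rfl⟩ := Nat.exists_eq_add_of_lt hnm
      rw [add_assoc, hin, hφβ]
      simp
    rw [orthonormal_iff_ite]
    intro i j
    rcases lt_trichotomy i j with h | h | h
    · rw [h2 i j h, if_neg h.ne]
    · rw [h, h1, if_pos rfl]
    · rw [← inner_conj_symm, h2 j i h, if_neg h.ne', map_zero]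
  refine ⟨hon.orthogonalFamily.linearIsometry.toContinuousLinearMap, ?_, ?_⟩
  · intro f z hz
    have hs := hon.orthogonalFamily.hasSum_linearIsometry f
    have hs2 := hs.mapL (innerSL ℂ (kern z hz))
    rw [eval_eq hz]
    refine hs2.unique ?_
    have := (hasSum_eval (hφmaps hz) f).mul_left (w z)
    refine (my_hasSum_congr fun n => ?_).2 this
    simp only [LinearIsometry.toSpanSingleton_apply, innerSL_apply_apply, inner_smul_right]
    rw [← eval_eq hz, (hasSum_eval hz (e n)).unique (he n z hz), hwdef z hz]
    simp only [hk]
    ring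
  · intro f
    exact hon.orthogonalFamily.linearIsometry.norm_map f
end

section
/- Let φ be a non-constant inner function with no zeros in 𝔻, let θ be any inner function, and set w = θ·(φ − φ(0))/‖φ − φ(0)‖₂. Then the weighted composition operator T_{w,φ} is an isometry on the Hardy space H². -/
open Complex Metric Filter Topology MeasureTheory

open scoped ComplexConjugate

/-- the point on the circle -/
noncomputable def cpt (r t : ℝ) : ℂ := (r : ℂ) * Complex.exp (t * Complex.I)

lemma cpt_norm {r : ℝ} (hr : 0 ≤ r) (t : ℝ) : ‖cpt r t‖ = r := by
  simp [cpt, Complex.norm_exp_ofReal_mul_I, abs_of_nonneg hr]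

lemma cpt_mem {r : ℝ} (hr : 0 ≤ r) (hr1 : r < 1) (t : ℝ) : cpt r t ∈ ball (0:ℂ) 1 := by
  simpa [cpt_norm hr] using hr1

lemma cpt_cont (r : ℝ) : Continuous (cpt r) := by unfold cpt; fun_prop

def IsPS (a : ℕ → ℂ) (g : ℂ → ℂ) : Prop :=
  ∀ z ∈ ball (0:ℂ) 1, HasSum (fun n => a n * z ^ n) (g z)

lemma hasSum_of_eq {f g : ℕ → ℂ} {x : ℂ} (h : HasSum g x) (e : ∀ n, f n = g n) : HasSum f x := by
  rwa [funext e]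

lemma int_exp (m k : ℕ) : ∫ t in (0:ℝ)..2 * Real.pi,
    conj (Complex.exp (t * Complex.I) ^ m) * Complex.exp (t * Complex.I) ^ k
      = if m = k then 2 * (Real.pi : ℂ) else 0 := by
  have h : ∀ t : ℝ, conj (Complex.exp (t * Complex.I) ^ m) * Complex.exp (t * Complex.I) ^ k
      = Complex.exp ((((k:ℂ) - m) * Complex.I) * t) := by
    intro t
    rw [map_pow, ← Complex.exp_conj, ← Complex.exp_nat_mul, ← Complex.exp_nat_mul,
      ← Complex.exp_add]
    congr 1
    simp
    ring
  simp_rw [h]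
  split_ifs with hmk
  · subst hmk; simp
  · have hne : ((k:ℂ) - m) * Complex.I ≠ 0 := by
      refine mul_ne_zero (sub_ne_zero.2 ?_) Complex.I_ne_zero
      exact_mod_cast Ne.symm hmk
    rw [integral_exp_mul_complex hne]
    have : Complex.exp (((k:ℂ) - m) * Complex.I * ((2 * Real.pi : ℝ) : ℂ)) = 1 := by
      rw [Complex.exp_eq_one_iff]
      exact ⟨(k:ℤ) - m, by push_cast; ring⟩
    rw [this]
    simp

lemma IsPS.summable {a g} (h : IsPS a g) {r : ℝ} (hr : 0 ≤ r) (hr1 : r < 1) :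
    Summable fun n => ‖a n‖ * r ^ n := by
  have := (h (r:ℂ) (by simpa [abs_of_nonneg hr] using hr1)).summable.norm
  simpa [abs_of_nonneg hr] using this

lemma IsPS.int_step {a g} (h : IsPS a g) {r : ℝ} (hr : 0 ≤ r) (hr1 : r < 1) (k : ℕ) :
    ∫ t in (0:ℝ)..2 * Real.pi, conj (g (cpt r t)) * Complex.exp (t * Complex.I) ^ k
      = 2 * Real.pi * (conj (a k) * r ^ k) := by
  have key := intervalIntegral.hasSum_integral_of_dominated_convergence (μ := volume)
    (a := 0) (b := 2 * Real.pi)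
    (F := fun m t => conj (a m * cpt r t ^ m) * Complex.exp (t * Complex.I) ^ k)
    (f := fun t => conj (g (cpt r t)) * Complex.exp (t * Complex.I) ^ k)
    (fun m _ => ‖a m‖ * r ^ m) (fun m => by
      have := cpt_cont r
      exact Continuous.aestronglyMeasurable (by fun_prop))
    (fun m => by
      refine ae_of_all _ fun t _ => ?_
      simp [cpt_norm hr, Complex.norm_exp_ofReal_mul_I])
    (ae_of_all _ fun t _ => h.summable hr hr1) (by simp)
    (ae_of_all _ fun t _ => by
      have := (h _ (cpt_mem hr hr1 t))
      exact (Complex.hasSum_conj'.2 (by simpa using this)).mul_right _)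
  have e : ∀ m, ∫ t in (0:ℝ)..2 * Real.pi, conj (a m * cpt r t ^ m) * Complex.exp (t * Complex.I) ^ k
      = if m = k then 2 * Real.pi * (conj (a k) * r ^ k) else 0 := by
    intro m
    have : ∀ t : ℝ, conj (a m * cpt r t ^ m) * Complex.exp (t * Complex.I) ^ k
      = (conj (a m) * r ^ m) * (conj (Complex.exp (t * Complex.I) ^ m) * Complex.exp (t * Complex.I) ^ k) := by
      intro t
      simp only [cpt, map_mul, mul_pow, map_pow, Complex.conj_ofReal]
      ring
    simp_rw [this]
    rw [intervalIntegral.integral_const_mul, int_exp]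
    split_ifs with hh
    · subst hh; ring
    · simp
  simp_rw [e] at key
  exact key.unique (hasSum_ite_eq k _)

lemma IsPS.int_conj_mul {a b g h} (hg : IsPS a g) (hh : IsPS b h)
    (hgc : ContinuousOn g (ball (0:ℂ) 1)) {M : ℝ} (hM : ∀ z ∈ ball (0:ℂ) 1, ‖g z‖ ≤ M)
    {r : ℝ} (hr : 0 ≤ r) (hr1 : r < 1) :
    HasSum (fun n => 2 * Real.pi * (conj (a n) * b n * (r ^ 2) ^ n))
     (∫ t in (0:ℝ)..2 * Real.pi, conj (g (cpt r t)) * h (cpt r t)) := by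
  have hgc' : Continuous fun t => g (cpt r t) := by
    rw [← continuousOn_univ]
    exact hgc.comp (cpt_cont r).continuousOn fun t _ => cpt_mem hr hr1 t
  have key := intervalIntegral.hasSum_integral_of_dominated_convergence (μ := volume)
    (a := 0) (b := 2 * Real.pi)
    (F := fun m t => conj (g (cpt r t)) * (b m * cpt r t ^ m))
    (f := fun t => conj (g (cpt r t)) * h (cpt r t))
    (fun m _ => M * (‖b m‖ * r ^ m)) (fun m => by
      have := cpt_cont r
      exact ((Complex.continuous_conj.comp hgc').mul
        (by fun_prop : Continuous fun t => b m * cpt r t ^ m)).aestronglyMeasurable)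
    (fun m => by
      refine ae_of_all _ fun t _ => ?_
      simp only [norm_mul, norm_pow, cpt_norm hr, RCLike.norm_conj]
      gcongr
      exact hM _ (cpt_mem hr hr1 t))
    (ae_of_all _ fun t _ => (hh.summable hr hr1).mul_left _) (by simp)
    (ae_of_all _ fun t _ => (hh _ (cpt_mem hr hr1 t)).mul_left _)
  refine hasSum_of_eq key fun n => ?_
  have : ∀ t : ℝ, conj (g (cpt r t)) * (b n * cpt r t ^ n)
    = (b n * r ^ n) * (conj (g (cpt r t)) * Complex.exp (t * Complex.I) ^ n) := by
    intro t
    simp only [cpt, mul_pow]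
    ring
  simp_rw [this]
  rw [intervalIntegral.integral_const_mul, hg.int_step hr hr1]
  ring

lemma exists_IsPS {g : ℂ → ℂ} (hg : DifferentiableOn ℂ g (ball (0:ℂ) 1)) : ∃ a, IsPS a g := by
  refine ⟨fun n => (n.factorial : ℂ)⁻¹ * iteratedDeriv n g 0, fun z hz => ?_⟩
  have := Complex.hasSum_taylorSeries_on_ball hg hz
  simp only [sub_zero, smul_eq_mul] at this
  refine hasSum_of_eq this fun n => ?_
  ring

lemma mean_value {g : ℂ → ℂ} (hg : DifferentiableOn ℂ g (ball (0:ℂ) 1))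
    {r : ℝ} (hr : 0 ≤ r) (hr1 : r < 1) :
    ∫ t in (0:ℝ)..2 * Real.pi, g (cpt r t) = 2 * Real.pi * g 0 := by
  obtain ⟨a, ha⟩ := exists_IsPS hg
  have h0 : g 0 = a 0 := by
    refine (ha 0 (by simp)).unique ?_
    convert hasSum_single (f := fun n => a n * (0:ℂ) ^ n) 0 ?_ using 1
    · simp
    · intro b hb; simp [hb]
  have := ha.int_step hr hr1 0
  simp only [pow_zero, mul_one] at this
  rw [h0, ← Complex.conj_conj (∫ t in (0:ℝ)..2 * Real.pi, g (cpt r t)), ← intervalIntegral.intervalIntegral_conj, this]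
  simp [Complex.conj_ofNat]

lemma memlp_of_bdd {a : ℕ → ℂ} {g : ℂ → ℂ} (hg : IsPS a g) 
    (hgc : ContinuousOn g (ball (0:ℂ) 1)) {M : ℝ} (hM : ∀ z ∈ ball (0:ℂ) 1, ‖g z‖ ≤ M) :
    Memℓp a 2 := by
  have hM0 : 0 ≤ M := (norm_nonneg _).trans (hM 0 (by simp))
  have hpi := Real.pi_pos
  apply memℓp_gen' (C := M ^ 2)
  intro s
  have hb : ∀ r ∈ Set.Ioo (0:ℝ) 1, ∑ i ∈ s, ‖a i‖ ^ 2 * (r ^ 2) ^ i ≤ M ^ 2 := by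
    intro r hr
    have hs := hg.int_conj_mul hg hgc hM hr.1.le hr.2
    have hs2 : HasSum (fun n => 2 * Real.pi * (‖a n‖ ^ 2 * (r ^ 2) ^ n))
      (∫ t in (0:ℝ)..2 * Real.pi, conj (g (cpt r t)) * g (cpt r t)).re := by
      have := Complex.hasSum_re hs
      convert this using 2 with n
      rw [Complex.conj_mul']
      norm_cast
    have h1 := sum_le_hasSum s (fun i _ => by positivity) hs2
    have h2 : ‖∫ t in (0:ℝ)..2 * Real.pi, conj (g (cpt r t)) * g (cpt r t)‖ ≤ M ^ 2 * |2 * Real.pi - 0| := by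
      apply intervalIntegral.norm_integral_le_of_norm_le_const
      intro t _
      rw [norm_mul, RCLike.norm_conj, ← sq]
      have := hM _ (cpt_mem hr.1.le hr.2 t)
      gcongr
    rw [sub_zero, abs_of_pos (by positivity)] at h2
    have h3 := h1.trans ((Complex.re_le_norm _).trans h2)
    rw [← Finset.mul_sum, mul_comm] at h3
    exact le_of_mul_le_mul_right h3 (by positivity)
  have hl : Tendsto (fun r : ℝ => ∑ i ∈ s, ‖a i‖ ^ 2 * (r ^ 2) ^ i) (𝓝[<] 1)
      (𝓝 (∑ i ∈ s, ‖a i‖ ^ 2 * ((1:ℝ) ^ 2) ^ i)) := by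
    refine Tendsto.mono_left ?_ nhdsWithin_le_nhds
    exact Continuous.tendsto (by fun_prop) 1
  have := le_of_tendsto hl (by
    filter_upwards [Ioo_mem_nhdsLT (show (0:ℝ) < 1 by norm_num)] with r hr using hb r hr)
  simpa using this

/-- the comparison function -/
noncomputable def Hk (a : ℂ) : ℕ → ℂ → ℂ
  | 0, l => (1 + conj a * a) - conj a * l - a * conj l
  | k+1, l => (1 + conj a * a) * l ^ (k+1) - conj a * l ^ (k+2) - a * l ^ k

lemma Hk_cont (a : ℂ) (k : ℕ) : Continuous (Hk a k) := by
  cases k with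
  | zero => change Continuous fun l => (1 + conj a * a) - conj a * l - a * conj l; fun_prop
  | succ k =>
    change Continuous fun l => (1 + conj a * a) * l ^ (k+1) - conj a * l ^ (k+2) - a * l ^ k
    fun_prop

lemma Hk_eq (a s l : ℂ) (m k : ℕ) (hs : ‖s‖ = 1) (hl : ‖l‖ = 1) :
    conj (s * (l - a) * l ^ m) * (s * (l - a) * l ^ (m + k)) = Hk a k l := by
  have h1 : conj s * s = 1 := by rw [Complex.conj_mul', hs]; simp
  have h2 : conj l * l = 1 := by rw [Complex.conj_mul', hl]; simp
  have h3 : (conj l) ^ m * l ^ m = 1 := by rw [← mul_pow, h2, one_pow]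
  have : conj (s * (l - a) * l ^ m) * (s * (l - a) * l ^ (m + k))
    = (conj s * s) * ((conj l) ^ m * l ^ m) * ((conj l * l) + conj a * a - conj a * l - a * conj l) * l ^ k := by
    simp only [map_mul, map_sub, map_pow, pow_add]; ring
  rw [this, h1, h2, h3]
  cases k with
  | zero => simp [Hk]
  | succ k =>
    simp only [Hk]
    linear_combination (-a * l ^ k) * h2

lemma Hk_int_aux (u : ℝ → ℂ) (hc : Continuous u) (a : ℂ)
    (mv : ∀ j : ℕ, ∫ t in (0:ℝ)..2 * Real.pi, u t ^ j = 2 * Real.pi * a ^ j) (k : ℕ) :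
    ∫ t in (0:ℝ)..2 * Real.pi, Hk a k (u t)
      = 2 * Real.pi * (if k = 0 then 1 - conj a * a else 0) := by
  have mv1 := mv 1
  simp only [pow_one] at mv1
  cases k with
  | zero =>
    simp only [Hk]
    rw [intervalIntegral.integral_sub, intervalIntegral.integral_sub,
      intervalIntegral.integral_const_mul, intervalIntegral.integral_const_mul,
      intervalIntegral.intervalIntegral_conj, mv1]
    · simp [Complex.conj_ofNat]; ring
    all_goals exact Continuous.intervalIntegrable (by fun_prop) _ _
  | succ k =>
    simp only [Hk]
    rw [intervalIntegral.integral_sub, intervalIntegral.integral_sub,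
      intervalIntegral.integral_const_mul, intervalIntegral.integral_const_mul,
      intervalIntegral.integral_const_mul, mv, mv, mv]
    · simp; ring
    all_goals exact Continuous.intervalIntegrable (by fun_prop) _ _

lemma Hk_int {φ : ℂ → ℂ} (hφ : DifferentiableOn ℂ φ (ball (0:ℂ) 1)) (k : ℕ)
    {r : ℝ} (hr : 0 ≤ r) (hr1 : r < 1) :
    ∫ t in (0:ℝ)..2 * Real.pi, Hk (φ 0) k (φ (cpt r t))
      = 2 * Real.pi * (if k = 0 then 1 - conj (φ 0) * φ 0 else 0) := by
  have hc : Continuous fun t => φ (cpt r t) := by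
    rw [← continuousOn_univ]
    exact hφ.continuousOn.comp (cpt_cont r).continuousOn fun t _ => cpt_mem hr hr1 t
  have mv : ∀ j, ∫ t in (0:ℝ)..2 * Real.pi, φ (cpt r t) ^ j = 2 * Real.pi * φ 0 ^ j := fun j =>
    mean_value (g := fun z => φ z ^ j) (hφ.pow j) hr hr1
  exact Hk_int_aux _ hc _ mv k

lemma inner_main {φ θ : ℂ → ℂ} (hφ : IsInnerFn φ) (hθ : IsInnerFn θ) (m k : ℕ) (A B : H2)
    (hA : IsPS A fun z => θ z * (φ z - φ 0) * φ z ^ m)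
    (hB : IsPS B fun z => θ z * (φ z - φ 0) * φ z ^ (m + k)) :
    inner ℂ A B = if k = 0 then 1 - conj (φ 0) * φ 0 else 0 := by
  obtain ⟨hφd, hφb, hφl⟩ := hφ
  obtain ⟨hθd, hθb, hθl⟩ := hθ
  have hpi : (2 * Real.pi : ℂ) ≠ 0 := by
    exact_mod_cast (by positivity : (2 * Real.pi : ℝ) ≠ 0)
  set D : ℂ → ℂ → ℂ := fun s l =>
    conj (s * (l - φ 0) * l ^ m) * (s * (l - φ 0) * l ^ (m + k)) - Hk (φ 0) k l with hD
  have hDc : Continuous fun p : ℂ × ℂ => D p.1 p.2 := by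
    have := Hk_cont (φ 0) k
    simp only [hD]
    fun_prop
  obtain ⟨C, hC⟩ := ((isCompact_closedBall (0:ℂ) 1).prod (isCompact_closedBall (0:ℂ) 1)).exists_bound_of_continuousOn hDc.continuousOn
  have hmem : ∀ᶠ r : ℝ in 𝓝[<] 1, r ∈ Set.Ioo (0:ℝ) 1 := Ioo_mem_nhdsLT (by norm_num)
  have cφ : ∀ r ∈ Set.Ioo (0:ℝ) 1, Continuous fun t => φ (cpt r t) := fun r hr => by
    rw [← continuousOn_univ]
    exact hφd.continuousOn.comp (cpt_cont r).continuousOn fun t _ => cpt_mem hr.1.le hr.2 t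
  have cθ : ∀ r ∈ Set.Ioo (0:ℝ) 1, Continuous fun t => θ (cpt r t) := fun r hr => by
    rw [← continuousOn_univ]
    exact hθd.continuousOn.comp (cpt_cont r).continuousOn fun t _ => cpt_mem hr.1.le hr.2 t
  have lim0 : Tendsto (fun r : ℝ => ∫ t in (0:ℝ)..2 * Real.pi, D (θ (cpt r t)) (φ (cpt r t)))
      (𝓝[<] 1) (𝓝 (∫ t in (0:ℝ)..2 * Real.pi, (0:ℂ))) := by
    apply intervalIntegral.tendsto_integral_filter_of_dominated_convergence (fun _ => C)
    · filter_upwards [hmem] with r hr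
      exact (hDc.comp ((cθ r hr).prodMk (cφ r hr))).aestronglyMeasurable
    · filter_upwards [hmem] with r hr
      refine ae_of_all _ fun t _ => hC (θ (cpt r t), φ (cpt r t)) ⟨?_, ?_⟩
      · simpa using hθb _ (cpt_mem hr.1.le hr.2 t)
      · simpa using hφb _ (cpt_mem hr.1.le hr.2 t)
    · simp
    · filter_upwards [hφl, hθl] with t ⟨l, hl, hlt⟩ ⟨s, hs, hst⟩ _
      have h := (hDc.tendsto (s, l)).comp (hst.prodMk_nhds hlt)
      have h0 : D s l = 0 := by simp only [hD]; rw [Hk_eq _ _ _ _ _ hs hl, sub_self]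
      simp only [h0] at h
      exact h
  have hGd : DifferentiableOn ℂ (fun z => θ z * (φ z - φ 0) * φ z ^ m) (ball (0:ℂ) 1) :=
    (hθd.mul (hφd.sub_const _)).mul (hφd.pow m)
  have hGb : ∀ z ∈ ball (0:ℂ) 1, ‖θ z * (φ z - φ 0) * φ z ^ m‖ ≤ 1 * (1 + 1) * 1 ^ m := by
    intro z hz
    rw [norm_mul, norm_mul, norm_pow]
    have h1 := hφb z hz
    have h2 := hφb 0 (by simp)
    have h3 := hθb z hz
    have h4 := norm_sub_le (φ z) (φ 0)
    gcongr
    linarith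
  have lim1 : Tendsto (fun r : ℝ => ∑' n, 2 * Real.pi * (conj (A n) * B n * ((r:ℂ) ^ 2) ^ n))
      (𝓝[<] 1) (𝓝 (2 * Real.pi * (if k = 0 then 1 - conj (φ 0) * φ 0 else 0))) := by
    have := lim0.add_const (2 * Real.pi * (if k = 0 then 1 - conj (φ 0) * φ 0 else 0))
    simp only [intervalIntegral.integral_zero, zero_add] at this
    refine this.congr' ?_
    filter_upwards [hmem] with r hr
    rw [(hA.int_conj_mul hB hGd.continuousOn hGb hr.1.le hr.2).tsum_eq,
      ← Hk_int hφd k hr.1.le hr.2, ← intervalIntegral.integral_add]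
    · simp [hD]
    · exact (hDc.comp ((cθ r hr).prodMk (cφ r hr))).intervalIntegrable _ _
    · exact ((Hk_cont _ _).comp (cφ r hr)).intervalIntegrable _ _
  have lim2 : Tendsto (fun r : ℝ => ∑' n, 2 * Real.pi * (conj (A n) * B n * ((r:ℂ) ^ 2) ^ n))
      (𝓝[<] 1) (𝓝 (∑' n, 2 * Real.pi * (conj (A n) * B n))) := by
    apply tendsto_tsum_of_dominated_convergence
      (bound := fun n => ‖2 * (Real.pi:ℂ)‖ * ‖inner ℂ (A n) (B n)‖)
    · exact (lp.summable_inner (𝕜 := ℂ) A B).norm.mul_left _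
    · intro n
      have : Tendsto (fun r : ℝ => 2 * Real.pi * (conj (A n) * B n * ((r:ℂ) ^ 2) ^ n)) (𝓝[<] 1)
        (𝓝 (2 * Real.pi * (conj (A n) * B n * (((1:ℝ):ℂ) ^ 2) ^ n))) :=
        (Continuous.tendsto (by fun_prop) 1).mono_left nhdsWithin_le_nhds
      simpa using this
    · filter_upwards [hmem] with r hr n
      rw [norm_mul]
      gcongr
      simp only [norm_mul, norm_pow, RCLike.inner_apply, Complex.norm_real, Real.norm_eq_abs, abs_of_pos hr.1]
      rw [mul_comm ‖B n‖]
      refine mul_le_of_le_one_right (by positivity) ?_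
      exact pow_le_one₀ (by positivity) (pow_le_one₀ hr.1.le hr.2.le)
  have := tendsto_nhds_unique lim2 lim1
  rw [tsum_mul_left] at this
  have := mul_left_cancel₀ hpi this
  rw [← this, lp.inner_eq_tsum]
  congr 1; ext n
  simp [RCLike.inner_apply, mul_comm]

lemma eval_inner {z : ℂ} (hz : z ∈ ball (0:ℂ) 1) : ∃ K : H2, ∀ f : H2,
    HasSum (fun n => f n * z ^ n) (inner ℂ K f) := by
  have hm : Memℓp (fun n : ℕ => conj (z ^ n)) 2 := by
    apply memℓp_gen
    have hz' : ‖z‖ < 1 := by simpa using hz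
    have : ∀ n : ℕ, ‖conj (z ^ n)‖ ^ (2:ENNReal).toReal = (‖z‖ ^ 2) ^ n := by
      intro n; simp [← pow_mul, mul_comm]
    simp_rw [this]
    exact summable_geometric_of_lt_one (by positivity) (by nlinarith [norm_nonneg z])
  refine ⟨⟨_, hm⟩, fun f => ?_⟩
  have := lp.hasSum_inner (𝕜 := ℂ) (⟨_, hm⟩ : H2) f
  simpa [RCLike.inner_apply] using this

theorem isometry_of_singular_inner_weight
    (φ θ : ℂ → ℂ)
    (hφmaps : Set.MapsTo φ (ball (0:ℂ) 1) (ball (0:ℂ) 1))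
    (hφ : IsInnerFn φ) (hθ : IsInnerFn θ)
    (hnonconst : ∃ z₁ ∈ ball (0:ℂ) 1, ∃ z₂ ∈ ball (0:ℂ) 1, φ z₁ ≠ φ z₂)
    (hnozero : ∀ z ∈ ball (0:ℂ) 1, φ z ≠ 0)
    (Φ : H2) (hΦ : ∀ z ∈ ball (0:ℂ) 1, H2.eval Φ z = φ z - φ 0)
    (w : ℂ → ℂ)
    (hwdef : ∀ z ∈ ball (0:ℂ) 1, w z = θ z * (φ z - φ 0) / (‖Φ‖ : ℂ)) :
    ∃ T : H2 →L[ℂ] H2,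
      (∀ (f : H2), ∀ z ∈ ball (0:ℂ) 1, H2.eval (T f) z = w z * H2.eval f (φ z)) ∧
      ∀ f : H2, ‖T f‖ = ‖f‖ := by
  have hone : IsInnerFn fun _ => (1:ℂ) :=
    ⟨differentiableOn_const _, by simp, ae_of_all _ fun t => ⟨1, by simp, tendsto_const_nhds⟩⟩
  have hΦps : IsPS Φ fun z => (1:ℂ) * (φ z - φ 0) * φ z ^ 0 := by
    intro z hz
    obtain ⟨K, hK⟩ := eval_inner hz
    have := (hK Φ).summable.hasSum
    simp only [one_mul, pow_zero, mul_one]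
    rw [← hΦ z hz]
    exact this
  have hΦn := inner_main hφ hone 0 0 Φ Φ hΦps hΦps
  simp only [if_true, inner_self_eq_norm_sq_to_K] at hΦn
  have ha : ‖φ 0‖ < 1 := by simpa using hφmaps (show (0:ℂ) ∈ ball (0:ℂ) 1 by simp)
  have hne : ‖Φ‖ ≠ 0 := by
    intro h0
    rw [h0, Complex.conj_mul'] at hΦn
    have : (1 : ℝ) - ‖φ 0‖ ^ 2 = 0 := by
      have h : ((0:ℝ):ℂ) ^ 2 = 1 - (‖φ 0‖:ℂ) ^ 2 := hΦn
      have h' : ((0:ℝ)) ^ 2 = 1 - (‖φ 0‖) ^ 2 := by exact_mod_cast h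
      linarith
    nlinarith [norm_nonneg (φ 0)]
  have hneC : (‖Φ‖ : ℂ) ≠ 0 := by exact_mod_cast hne
  have hex : ∀ n : ℕ, ∃ g : H2, IsPS g fun z => θ z * (φ z - φ 0) * φ z ^ n := by
    intro n
    have hGd : DifferentiableOn ℂ (fun z => θ z * (φ z - φ 0) * φ z ^ n) (ball (0:ℂ) 1) :=
      (hθ.1.mul (hφ.1.sub_const _)).mul (hφ.1.pow n)
    have hGb : ∀ z ∈ ball (0:ℂ) 1, ‖θ z * (φ z - φ 0) * φ z ^ n‖ ≤ 1 * (1 + 1) * 1 ^ n := by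
      intro z hz
      rw [norm_mul, norm_mul, norm_pow]
      have h1 := hφ.2.1 z hz
      have h2 := hφ.2.1 0 (by simp)
      have h3 := hθ.2.1 z hz
      have h4 := norm_sub_le (φ z) (φ 0)
      gcongr
      linarith
    obtain ⟨a, ha⟩ := exists_IsPS hGd
    exact ⟨⟨a, memlp_of_bdd ha hGd.continuousOn hGb⟩, ha⟩
  choose g hg using hex
  have hin : ∀ m n, inner ℂ (g m) (g n) = if m = n then (‖Φ‖ : ℂ) ^ 2 else 0 := by
    have hle : ∀ m k, inner ℂ (g m) (g (m + k)) = if k = 0 then (‖Φ‖ : ℂ) ^ 2 else 0 := by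
      intro m k
      rw [inner_main hφ hθ m k _ _ (hg m) (hg (m + k))]
      split_ifs
      · exact hΦn.symm
      · rfl
    intro m n
    rcases le_total m n with h | h
    · obtain ⟨k, rfl⟩ := Nat.exists_eq_add_of_le h
      rw [hle]; simp
    · obtain ⟨k, rfl⟩ := Nat.exists_eq_add_of_le h
      rw [← inner_conj_symm, hle]
      by_cases hk : k = 0 <;> simp [hk]
  set e : ℕ → H2 := fun n => ((‖Φ‖ : ℂ)⁻¹) • g n with he
  have hon : Orthonormal ℂ e := by
    rw [orthonormal_iff_ite]
    intro m n
    simp only [he, inner_smul_left, inner_smul_right, hin]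
    split_ifs
    · simp; field_simp
    · simp
  have hof := hon.orthogonalFamily
  refine ⟨hof.linearIsometry.toContinuousLinearMap, fun f z hz => ?_, fun f => ?_⟩
  · obtain ⟨K, hK⟩ := eval_inner hz
    have hev : ∀ F : H2, H2.eval F z = inner ℂ K F := fun F => (hK F).tsum_eq
    have hs := (hof.hasSum_linearIsometry f).mapL (innerSL ℂ K)
    simp only [LinearIsometry.toSpanSingleton_apply, map_smul, innerSL_apply_apply] at hs
    rw [hev]
    change inner ℂ K (hof.linearIsometry f) = _
    rw [← hs.tsum_eq, H2.eval, ← tsum_mul_left]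
    congr 1; ext n
    have : inner ℂ K (g n) = θ z * (φ z - φ 0) * φ z ^ n := (hK (g n)).unique (hg n z hz)
    simp only [he, inner_smul_right, this, hwdef z hz, smul_eq_mul]
    ring
  · exact hof.linearIsometry.norm_map f
end

section
/- Let φ: 𝔻 → 𝔻 be holomorphic and w holomorphic on 𝔻 such that T_{w,φ} defines a bounded operator on the Bergman space A², and define the Borel measure μ on 𝔻 by μ(A) = ∫_{φ^{-1}(A)} |w(z)|² dm(z), so that ‖T_{w,φ}f‖² = ∫_𝔻 |f|² dμ for all f ∈ A². Then T_{w,φ} is an isometry on A² if and only if μ coincides with the normalized area measure m on 𝔻. -/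
open Complex Metric Filter Topology MeasureTheory
open scoped ENNReal NNReal

/-- Normalized area (Lebesgue) measure on the unit disc, of total mass one. -/
noncomputable def mDisc : Measure ℂ :=
  (ENNReal.ofReal Real.pi)⁻¹ • (volume.restrict (ball (0:ℂ) 1))

lemma aux_nn (z : ℂ) : (‖z‖₊ : ℝ≥0∞) ^ 2 = ENNReal.ofReal (‖z‖ ^ 2) := by
  rw [ENNReal.ofReal_pow (norm_nonneg _), ofReal_norm]; rfl

lemma aux_ae : ∀ᵐ z ∂mDisc, z ∈ ball (0:ℂ) 1 := by
  unfold mDisc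
  exact Measure.ae_smul_measure (ae_restrict_mem measurableSet_ball) _

lemma aux_int (h : ℂ → ℝ) (hh : Continuous h) : Integrable h mDisc := by
  unfold mDisc
  refine Integrable.smul_measure ?_ (by simp [Real.pi_pos])
  exact (hh.continuousOn.integrableOn_compact (isCompact_closedBall (0:ℂ) 1)).mono_set
    ball_subset_closedBall

lemma aux_pt (a b : ℂ) : a * (starRingEnd ℂ) b =
    (1/4 : ℂ) * ((((‖a + b‖ ^ 2 : ℝ) : ℂ) - ((‖a - b‖ ^ 2 : ℝ) : ℂ))
      + I * (((‖a + I * b‖ ^ 2 : ℝ) : ℂ) - ((‖a - I * b‖ ^ 2 : ℝ) : ℂ))) := by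
  simp only [← Complex.normSq_eq_norm_sq, Complex.normSq_apply]
  apply Complex.ext <;> simp <;> ring

lemma aux_exp (x t : ℂ) : Complex.exp ((inner ℝ x t : ℝ) * I) =
    Complex.exp (I * (starRingEnd ℂ) t * x / 2) *
      (starRingEnd ℂ) (Complex.exp (-(I * (starRingEnd ℂ) t * x / 2))) := by
  rw [← Complex.exp_conj, ← Complex.exp_add]
  congr 1
  rw [Complex.inner]
  have h2 : (starRingEnd ℂ) (2:ℂ) = 2 := Complex.conj_ofNat 2
  simp only [map_neg, map_div₀, map_mul, h2, Complex.conj_conj, Complex.conj_I]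
  apply Complex.ext <;> simp <;> ring

lemma aux_meas (f : ℂ → ℂ) (hf : ContinuousOn f (ball (0:ℂ) 1)) :
    Measurable ((ball (0:ℂ) 1).indicator f) := by
  classical
  have h : Measurable ((ball (0:ℂ) 1).piecewise f (fun _ => (0:ℂ))) :=
    hf.measurable_piecewise continuousOn_const measurableSet_ball
  have h2 : (ball (0:ℂ) 1).indicator f = (ball (0:ℂ) 1).piecewise f (fun _ => (0:ℂ)) :=
    (Set.piecewise_eq_indicator).symm
  rw [h2]
  exact h

lemma aux_lin (ν : Measure ℂ) (f g h k : ℂ → ℝ) (hf : Integrable f ν) (hg : Integrable g ν)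
    (hh : Integrable h ν) (hk : Integrable k ν) :
    (∫ x, (1/4 : ℂ) * (((f x : ℂ) - (g x : ℂ)) + I * ((h x : ℂ) - (k x : ℂ))) ∂ν) =
    (1/4 : ℂ) * ((((∫ x, f x ∂ν : ℝ) : ℂ) - ((∫ x, g x ∂ν : ℝ) : ℂ))
      + I * (((∫ x, h x ∂ν : ℝ) : ℂ) - ((∫ x, k x ∂ν : ℝ) : ℂ))) := by
  have hf' : Integrable (fun x => (f x : ℂ)) ν := hf.ofReal
  have hg' : Integrable (fun x => (g x : ℂ)) ν := hg.ofReal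
  have hh' : Integrable (fun x => (h x : ℂ)) ν := hh.ofReal
  have hk' : Integrable (fun x => (k x : ℂ)) ν := hk.ofReal
  have h1 : Integrable (fun x => (f x : ℂ) - (g x : ℂ)) ν := hf'.sub hg'
  have h2 : Integrable (fun x => (h x : ℂ) - (k x : ℂ)) ν := hh'.sub hk'
  have h3 : Integrable (fun x => I * ((h x : ℂ) - (k x : ℂ))) ν := h2.const_mul I
  rw [integral_const_mul, integral_add h1 h3, integral_const_mul, integral_sub hf' hg',
    integral_sub hh' hk']
  simp only [integral_complex_ofReal]

lemma aux_ext (μ : Measure ℂ) [IsFiniteMeasure μ] [IsFiniteMeasure mDisc]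
    (H : ∀ f : ℂ → ℂ, Differentiable ℂ f →
      (∫⁻ z, (‖f z‖₊ : ℝ≥0∞) ^ 2 ∂μ) = ∫⁻ z, (‖f z‖₊ : ℝ≥0∞) ^ 2 ∂mDisc) : μ = mDisc := by
  have H1 : ∀ f : ℂ → ℂ, Differentiable ℂ f → Integrable (fun z => ‖f z‖ ^ 2) μ ∧
      Integrable (fun z => ‖f z‖ ^ 2) mDisc ∧
      (∫ z, ‖f z‖ ^ 2 ∂μ) = ∫ z, ‖f z‖ ^ 2 ∂mDisc := by
    intro f hf
    have hc : Continuous (fun z => ‖f z‖ ^ 2) := by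
      have := hf.continuous
      fun_prop
    have hi := aux_int _ hc
    have hH := H f hf
    simp only [aux_nn] at hH
    have hnn : ∀ ν : Measure ℂ, 0 ≤ᵐ[ν] (fun z => ‖f z‖ ^ 2) :=
      fun ν => Filter.Eventually.of_forall (fun z => by positivity)
    refine ⟨?_, hi, ?_⟩
    · refine (lintegral_ofReal_ne_top_iff_integrable hc.aestronglyMeasurable (hnn μ)).1 ?_
      rw [hH]
      exact hi.lintegral_lt_top.ne
    · rw [integral_eq_lintegral_of_nonneg_ae (hnn μ) hc.aestronglyMeasurable,
        integral_eq_lintegral_of_nonneg_ae (hnn _) hc.aestronglyMeasurable, hH]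
  apply Measure.ext_of_charFun
  funext t
  simp only [charFun_apply]
  set a : ℂ → ℂ := fun x => Complex.exp (I * (starRingEnd ℂ) t * x / 2) with ha
  set b : ℂ → ℂ := fun x => Complex.exp (-(I * (starRingEnd ℂ) t * x / 2)) with hb
  have da : Differentiable ℂ a := by fun_prop
  have db : Differentiable ℂ b := by fun_prop
  have e : ∀ x : ℂ, Complex.exp ((inner ℝ x t : ℝ) * I) =
      (1/4 : ℂ) * ((((‖a x + b x‖ ^ 2 : ℝ) : ℂ) - ((‖a x - b x‖ ^ 2 : ℝ) : ℂ))
      + I * (((‖a x + I * b x‖ ^ 2 : ℝ) : ℂ) - ((‖a x - I * b x‖ ^ 2 : ℝ) : ℂ))) := by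
    intro x
    rw [aux_exp, aux_pt]
  obtain ⟨p1, q1, r1⟩ := H1 (fun x => a x + b x) (by fun_prop)
  obtain ⟨p2, q2, r2⟩ := H1 (fun x => a x - b x) (by fun_prop)
  obtain ⟨p3, q3, r3⟩ := H1 (fun x => a x + I * b x) (by fun_prop)
  obtain ⟨p4, q4, r4⟩ := H1 (fun x => a x - I * b x) (by fun_prop)
  simp only [e]
  rw [aux_lin μ _ _ _ _ p1 p2 p3 p4, aux_lin mDisc _ _ _ _ q1 q2 q3 q4, r1, r2, r3, r4]

/-- Let `φ : 𝔻 → 𝔻` and `w` be holomorphic with `T_{w,φ}` bounded on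
the Bergman space `A²`, and let `μ` be the Borel measure on `𝔻` with
`μ(A) = ∫_{φ⁻¹(A)} |w|² dm`.  Then `T_{w,φ}` is an isometry on `A²` if and only if
`μ` coincides with the normalized area measure `m`. -/
theorem bergman_isometry_iff_pullback_measure_eq
    (φ w : ℂ → ℂ)
    (hφ : DifferentiableOn ℂ φ (ball (0:ℂ) 1))
    (hφmaps : Set.MapsTo φ (ball (0:ℂ) 1) (ball (0:ℂ) 1))
    (hw : DifferentiableOn ℂ w (ball (0:ℂ) 1))
    (hbdd : ∃ C : ℝ≥0∞, C ≠ ⊤ ∧ ∀ f : ℂ → ℂ, DifferentiableOn ℂ f (ball (0:ℂ) 1) →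
        (∫⁻ z, (‖f z‖₊ : ℝ≥0∞) ^ 2 ∂mDisc) < ⊤ →
        (∫⁻ z, (‖w z * f (φ z)‖₊ : ℝ≥0∞) ^ 2 ∂mDisc) ≤
          C * ∫⁻ z, (‖f z‖₊ : ℝ≥0∞) ^ 2 ∂mDisc)
    (μ : Measure ℂ)
    (hμ : ∀ A : Set ℂ, MeasurableSet A → μ A = ∫⁻ z in φ ⁻¹' A, (‖w z‖₊ : ℝ≥0∞) ^ 2 ∂mDisc) :
    (∀ f : ℂ → ℂ, DifferentiableOn ℂ f (ball (0:ℂ) 1) →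
        (∫⁻ z, (‖f z‖₊ : ℝ≥0∞) ^ 2 ∂mDisc) < ⊤ →
        (∫⁻ z, (‖w z * f (φ z)‖₊ : ℝ≥0∞) ^ 2 ∂mDisc) = ∫⁻ z, (‖f z‖₊ : ℝ≥0∞) ^ 2 ∂mDisc)
      ↔ μ = mDisc := by
  have hfin : IsFiniteMeasure mDisc := by
    have := aux_int (fun _ => (1:ℝ)) continuous_const
    rw [integrable_const_iff] at this
    simpa using this
  set B := ball (0:ℂ) 1 with hB
  set φ' := B.indicator φ with hφ'
  set w' := B.indicator w with hw'
  have mφ : Measurable φ' := aux_meas φ hφ.continuousOn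
  have mw : Measurable w' := aux_meas w hw.continuousOn
  have mw2 : Measurable (fun z => (‖w' z‖₊ : ℝ≥0∞) ^ 2) := by fun_prop
  have hae : ∀ᵐ z ∂mDisc, z ∈ B := aux_ae
  have hμ' : μ = (mDisc.withDensity (fun z => (‖w' z‖₊ : ℝ≥0∞) ^ 2)).map φ' := by
    ext A hA
    rw [hμ A hA, Measure.map_apply mφ hA, withDensity_apply _ (mφ hA)]
    have hs : (φ ⁻¹' A : Set ℂ) =ᵐ[mDisc] (φ' ⁻¹' A : Set ℂ) := by
      refine Filter.eventuallyEq_set.2 ?_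
      filter_upwards [hae] with z hz
      simp [hφ', Set.indicator_of_mem hz]
    rw [setLIntegral_congr hs]
    refine lintegral_congr_ae (ae_restrict_of_ae ?_)
    filter_upwards [hae] with z hz
    simp [hw', Set.indicator_of_mem hz]
  have key : ∀ f : ℂ → ℂ, DifferentiableOn ℂ f B →
      (∫⁻ z, (‖w z * f (φ z)‖₊ : ℝ≥0∞) ^ 2 ∂mDisc) =
        ∫⁻ z, (‖B.indicator f z‖₊ : ℝ≥0∞) ^ 2 ∂μ := by
    intro f hf
    have mf := aux_meas f hf.continuousOn
    have mf2 : Measurable (fun z => (‖B.indicator f z‖₊ : ℝ≥0∞) ^ 2) := by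
      exact (mf.nnnorm.coe_nnreal_ennreal).pow_const 2
    rw [hμ', lintegral_map mf2 mφ]
    have hl := lintegral_withDensity_eq_lintegral_mul mDisc mw2 (mf2.comp mφ)
    simp only [Function.comp_def] at hl
    rw [hl]
    refine lintegral_congr_ae ?_
    filter_upwards [hae] with z hz
    simp only [Pi.mul_apply, Function.comp, hw', hφ', Set.indicator_of_mem hz,
      Set.indicator_of_mem (hφmaps hz), nnnorm_mul, ENNReal.coe_mul, mul_pow]
  have hμB : ∀ᵐ z ∂μ, z ∈ B := by
    rw [ae_iff]
    have : {z | z ∉ B} = Bᶜ := rfl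
    rw [this, hμ _ measurableSet_ball.compl]
    have h0 : mDisc (φ ⁻¹' Bᶜ) = 0 := by
      refine measure_mono_null ?_ (ae_iff.1 hae)
      intro z hz hz'
      exact hz (hφmaps hz')
    exact setLIntegral_measure_zero _ _ h0
  have ind : ∀ (ν : Measure ℂ), (∀ᵐ z ∂ν, z ∈ B) → ∀ f : ℂ → ℂ,
      (∫⁻ z, (‖B.indicator f z‖₊ : ℝ≥0∞) ^ 2 ∂ν) = ∫⁻ z, (‖f z‖₊ : ℝ≥0∞) ^ 2 ∂ν := by
    intro ν hν f
    refine lintegral_congr_ae ?_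
    filter_upwards [hν] with z hz
    simp [Set.indicator_of_mem hz]
  constructor
  · intro h
    have H : ∀ f : ℂ → ℂ, Differentiable ℂ f →
      (∫⁻ z, (‖f z‖₊ : ℝ≥0∞) ^ 2 ∂μ) = ∫⁻ z, (‖f z‖₊ : ℝ≥0∞) ^ 2 ∂mDisc := by
      intro f hf
      have hc : Continuous (fun z => ‖f z‖ ^ 2) := by
        have := hf.continuous
        fun_prop
      rw [← ind μ hμB, ← key f hf.differentiableOn]
      refine h f hf.differentiableOn ?_
      simp only [aux_nn]
      exact (aux_int _ hc).lintegral_lt_top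
    have : IsFiniteMeasure μ := by
      have h1 := H (fun _ => 1) (differentiable_const _)
      simp at h1
      exact ⟨by rw [h1]; exact measure_lt_top _ _⟩
    exact aux_ext μ H
  · intro h f hf _
    rw [key f hf, ind μ hμB, h]
end

section
/- Let φ: 𝔻 → 𝔻 be holomorphic and suppose there is an integer N ∈ ℕ such that, for almost every z ∈ 𝔻 with respect to area measure, the fibre φ^{-1}({z}) has exactly N elements. Then for every constant c ∈ ℂ with |c| = 1, the weight w = c·φ′/√N induces an isometric weighted composition operator T_{w,φ} on the Bergman space A². -/
open Complex Metric Filter Topology MeasureTheory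
open scoped ENNReal NNReal

theorem aux_det (a : ℂ) :
    ((ContinuousLinearMap.toSpanSingleton ℂ a).restrictScalars ℝ : ℂ →L[ℝ] ℂ).det = ‖a‖ ^ 2 := by
  rw [ContinuousLinearMap.det]
  have : (((ContinuousLinearMap.toSpanSingleton ℂ a).restrictScalars ℝ : ℂ →L[ℝ] ℂ) : ℂ →ₗ[ℝ] ℂ)
      = Algebra.lmul ℝ ℂ a := by
    ext x <;> simp [mul_comm]
  rw [this, ← Complex.normSq_eq_norm_sq, ← Algebra.norm_complex_apply, Algebra.norm_apply]

theorem aux_partition (φ : ℂ → ℂ) (G : Set ℂ) (f' : ℂ → ℂ →L[ℝ] ℂ)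
    (hf' : ∀ x ∈ G, HasFDerivWithinAt φ (f' x) G x) (hd : ∀ x ∈ G, (f' x).det ≠ 0) :
    ∃ t : ℕ → Set ℂ, Pairwise (Function.onFun Disjoint t) ∧ (∀ n, MeasurableSet (t n)) ∧
      G ⊆ (⋃ n, t n) ∧ ∀ n, Set.InjOn φ (G ∩ t n) := by
  classical
  have key : ∀ A : ℂ →L[ℝ] ℂ, ∃ r : ℝ≥0, r ≠ 0 ∧ (A.det ≠ 0 → ∀ s : Set ℂ,
      ApproximatesLinearOn φ A s r → Set.InjOn φ s) := by
    intro A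
    by_cases hA : A.det = 0
    · exact ⟨1, one_ne_zero, fun h => absurd hA h⟩
    · let B := A.toContinuousLinearEquivOfDetNeZero hA
      have hBpos : 0 < ‖(B.symm : ℂ →L[ℝ] ℂ)‖₊⁻¹ := by
        rw [inv_pos]
        rcases B.subsingleton_or_nnnorm_symm_pos with h | h
        · exact absurd h (not_subsingleton ℂ)
        · exact h
      refine ⟨‖(B.symm : ℂ →L[ℝ] ℂ)‖₊⁻¹ / 2, (half_pos hBpos).ne', fun _ s hs => ?_⟩
      have hs' : ApproximatesLinearOn φ (B : ℂ →L[ℝ] ℂ) s (‖(B.symm : ℂ →L[ℝ] ℂ)‖₊⁻¹ / 2) := by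
        simpa [B] using hs
      exact hs'.injOn (Or.inr (NNReal.half_lt_self hBpos.ne'))
  choose r hr hrinj using key
  obtain ⟨t, A, h1, h2, h3, h4, h5⟩ :=
    exists_partition_approximatesLinearOn_of_hasFDerivWithinAt φ G f' hf' r hr
  refine ⟨t, h1, h2, h3, fun n => ?_⟩
  rcases G.eq_empty_or_nonempty with h | h
  · simp [h]
  · obtain ⟨y, hy, hAy⟩ := h5 h n
    exact hrinj (A n) (by rw [hAy]; exact hd y hy) _ (h4 n)

theorem aux_count (φ : ℂ → ℂ) (G : Set ℂ) (t : ℕ → Set ℂ)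
    (h1 : Pairwise (Function.onFun Disjoint t)) (h2 : ∀ n, MeasurableSet (t n))
    (h3 : G ⊆ ⋃ n, t n) (h4 : ∀ n, Set.InjOn φ (G ∩ t n)) (N : ℕ) (hN : 0 < N) (w : ℂ)
    (hw : (G ∩ φ ⁻¹' {w}).ncard = N) :
    ∑' n, (φ '' (G ∩ t n)).indicator (fun _ => (1 : ℝ≥0∞)) w = N := by
  set F := G ∩ φ ⁻¹' {w} with hF
  have hfin : F.Finite := Set.finite_of_ncard_pos (by omega)
  have hFc : (Measure.count F : ℝ≥0∞) = N := by
    rw [Measure.count_apply_finite _ hfin, ← hw, Set.ncard_eq_toFinset_card _ hfin]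
  have hFU : F = ⋃ n, F ∩ t n := by
    rw [← Set.inter_iUnion, eq_comm, Set.inter_eq_left]
    exact fun x hx => h3 hx.1
  rw [← hFc]
  conv_rhs => rw [hFU]
  rw [measure_iUnion (fun i j hij => (h1 hij).mono Set.inter_subset_right Set.inter_subset_right)
    (fun n => hfin.measurableSet.inter (h2 n))]
  congr 1
  ext1 n
  by_cases hm : w ∈ φ '' (G ∩ t n)
  · rw [Set.indicator_of_mem hm]
    obtain ⟨x, hx, hxw⟩ := hm
    have : F ∩ t n = {x} := by
      ext y
      constructor
      · rintro ⟨⟨hy, hyw⟩, hyt⟩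
        exact h4 n ⟨hy, hyt⟩ hx (by rw [hxw]; exact hyw)
      · rintro rfl
        exact ⟨⟨hx.1, hxw⟩, hx.2⟩
    rw [this, Measure.count_singleton]
  · rw [Set.indicator_of_notMem hm]
    have : F ∩ t n = ∅ := by
      ext y
      simp only [Set.mem_empty_iff_false, iff_false]
      rintro ⟨⟨hy, hyw⟩, hyt⟩
      exact hm ⟨y, ⟨hy, hyt⟩, hyw⟩
    rw [this, measure_empty]

theorem aux_area (φ : ℂ → ℂ)
    (hφ : DifferentiableOn ℂ φ (ball (0:ℂ) 1))
    (hφmaps : Set.MapsTo φ (ball (0:ℂ) 1) (ball (0:ℂ) 1))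
    (N : ℕ) (hN : 0 < N)
    (hfib : ∀ᵐ z ∂(volume.restrict (ball (0:ℂ) 1)),
      (ball (0:ℂ) 1 ∩ φ ⁻¹' {z}).ncard = N) (h : ℂ → ℝ≥0∞)
    (hh : AEMeasurable h (volume.restrict (ball (0:ℂ) 1))) :
    ∫⁻ z in ball (0:ℂ) 1, ENNReal.ofReal (‖deriv φ z‖ ^ 2) * h (φ z)
      = N * ∫⁻ z in ball (0:ℂ) 1, h z := by
  set D := ball (0:ℂ) 1 with hD
  let f' : ℂ → ℂ →L[ℝ] ℂ := fun z =>
    (ContinuousLinearMap.toSpanSingleton ℂ (deriv φ z)).restrictScalars ℝ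
  have hf' : ∀ x ∈ D, HasFDerivAt φ (f' x) x := fun x hx =>
    ((hφ.differentiableAt (isOpen_ball.mem_nhds hx)).hasDerivAt.hasFDerivAt).restrictScalars ℝ
  have hdet : ∀ x, (f' x).det = ‖deriv φ x‖ ^ 2 := fun x => aux_det _
  let Z : Set ℂ := {z | deriv φ z = 0}
  have hZ : MeasurableSet Z := measurable_deriv φ (measurableSet_singleton 0)
  let G := D \ Z
  have hGm : MeasurableSet G := measurableSet_ball.diff hZ
  have hGd : ∀ x ∈ G, (f' x).det ≠ 0 := fun x hx => by
    rw [hdet]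
    have : deriv φ x ≠ 0 := hx.2
    positivity
  obtain ⟨t, h1, h2, h3, h4⟩ := aux_partition φ G f'
    (fun x hx => (hf' x hx.1).hasFDerivWithinAt) hGd
  have hnull : volume (φ '' (D ∩ Z)) = 0 :=
    addHaar_image_eq_zero_of_det_fderivWithin_eq_zero volume
      (fun x hx => (hf' x hx.1).hasFDerivWithinAt)
      (fun x hx => by rw [hdet, show deriv φ x = 0 from hx.2]; simp)
  have hAm : ∀ n, MeasurableSet (G ∩ t n) := fun n => hGm.inter (h2 n)
  have hAd : ∀ n, ∀ x ∈ G ∩ t n, HasFDerivWithinAt φ (f' x) (G ∩ t n) x :=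
    fun n x hx => (hf' x hx.1.1).hasFDerivWithinAt
  have hIm : ∀ n, MeasurableSet (φ '' (G ∩ t n)) := fun n =>
    measurable_image_of_fderivWithin (hAm n) (hAd n) (h4 n)
  have hID : ∀ n, φ '' (G ∩ t n) ⊆ D := by
    rintro n _ ⟨x, hx, rfl⟩
    exact hφmaps hx.1.1
  have hGU : G = ⋃ n, G ∩ t n := by
    rw [← Set.inter_iUnion, eq_comm, Set.inter_eq_left]
    exact h3
  have hae : ∀ᵐ w ∂(volume.restrict D),
      ∑' n, (φ '' (G ∩ t n)).indicator (fun _ => (1 : ℝ≥0∞)) w = N := by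
    have hn' : ∀ᵐ w ∂(volume.restrict D), w ∉ φ '' (D ∩ Z) :=
      ae_restrict_of_ae (measure_eq_zero_iff_ae_notMem.1 hnull)
    filter_upwards [hfib, hn'] with w hw hwn
    refine aux_count φ G t h1 h2 h3 h4 N hN w ?_
    rw [← hw]
    congr 1
    ext x
    constructor
    · rintro ⟨hx, hxw⟩
      exact ⟨hx.1, hxw⟩
    · rintro ⟨hx, hxw⟩
      exact ⟨⟨hx, fun hz => hwn ⟨x, ⟨hx, hz⟩, hxw⟩⟩, hxw⟩
  calc ∫⁻ z in D, ENNReal.ofReal (‖deriv φ z‖ ^ 2) * h (φ z)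
      = ∫⁻ z in G, ENNReal.ofReal (‖deriv φ z‖ ^ 2) * h (φ z) := by
        rw [← lintegral_inter_add_sdiff _ D hZ]
        have : ∫⁻ z in D ∩ Z, ENNReal.ofReal (‖deriv φ z‖ ^ 2) * h (φ z) = 0 := by
          rw [setLIntegral_congr_fun (g := fun _ => 0) (measurableSet_ball.inter hZ)]
          · simp
          · intro x hx
            simp [show deriv φ x = 0 from hx.2]
        rw [this, zero_add]
    _ = ∑' n, ∫⁻ z in G ∩ t n, ENNReal.ofReal (‖deriv φ z‖ ^ 2) * h (φ z) := by
        conv_lhs => rw [hGU]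
        exact lintegral_iUnion hAm
          (fun i j hij => (h1 hij).mono Set.inter_subset_right Set.inter_subset_right) _
    _ = ∑' n, ∫⁻ w in φ '' (G ∩ t n), h w := by
        congr 1
        ext1 n
        rw [lintegral_image_eq_lintegral_abs_det_fderiv_mul volume (hAm n) (hAd n) (h4 n)]
        simp_rw [hdet, abs_pow, abs_norm]
    _ = ∑' n, ∫⁻ w in D, (φ '' (G ∩ t n)).indicator (fun _ => (1 : ℝ≥0∞)) w * h w := by
        congr 1
        ext1 n
        have : ∀ w, (φ '' (G ∩ t n)).indicator (fun _ => (1 : ℝ≥0∞)) w * h w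
            = (φ '' (G ∩ t n)).indicator h w := by
          intro w
          by_cases hw : w ∈ φ '' (G ∩ t n)
          · simp only [Set.indicator_of_mem hw, one_mul]
          · simp only [Set.indicator_of_notMem hw, zero_mul]
        simp_rw [this]
        rw [lintegral_indicator (hIm n), Measure.restrict_restrict (hIm n),
          Set.inter_eq_left.2 (hID n)]
    _ = ∫⁻ w in D, ∑' n, (φ '' (G ∩ t n)).indicator (fun _ => (1 : ℝ≥0∞)) w * h w := by
        rw [lintegral_tsum]
        intro n
        exact ((measurable_const.indicator (hIm n)).aemeasurable).mul hh
    _ = ∫⁻ w in D, N * h w := by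
        apply lintegral_congr_ae
        filter_upwards [hae] with w hw
        rw [ENNReal.tsum_mul_right, hw]
    _ = N * ∫⁻ w in D, h w := by
        rw [lintegral_const_mul' _ _ (ENNReal.natCast_ne_top N)]

/-- Let `φ : 𝔻 → 𝔻` be holomorphic and suppose there is `N ∈ ℕ`,
`N ≥ 1`, such that for almost every `z ∈ 𝔻` (area measure) the fibre `φ⁻¹({z})` in `𝔻`
has exactly `N` elements.  Then for every unimodular constant `c`, the weight
`w = c·φ′/√N` induces an isometric weighted composition operator `T_{w,φ}` on the
Bergman space `A²`. -/
theorem bergman_isometry_of_ae_N_fibres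
    (φ : ℂ → ℂ)
    (hφ : DifferentiableOn ℂ φ (ball (0:ℂ) 1))
    (hφmaps : Set.MapsTo φ (ball (0:ℂ) 1) (ball (0:ℂ) 1))
    (N : ℕ) (hN : 0 < N)
    (hfib : ∀ᵐ z ∂(volume.restrict (ball (0:ℂ) 1)),
      (ball (0:ℂ) 1 ∩ φ ⁻¹' {z}).ncard = N) :
    ∀ c : ℂ, ‖c‖ = 1 →
      ∀ f : ℂ → ℂ, DifferentiableOn ℂ f (ball (0:ℂ) 1) →
        (∫⁻ z, (‖f z‖₊ : ℝ≥0∞) ^ 2 ∂mDisc) < ⊤ →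
        (∫⁻ z, (‖(c * deriv φ z / (Real.sqrt N : ℂ)) * f (φ z)‖₊ : ℝ≥0∞) ^ 2 ∂mDisc)
          = ∫⁻ z, (‖f z‖₊ : ℝ≥0∞) ^ 2 ∂mDisc := by
  intro c hc f hf _
  have hh : AEMeasurable (fun z => (‖f z‖₊ : ℝ≥0∞) ^ 2) (volume.restrict (ball (0:ℂ) 1)) := by
    have := hf.continuousOn.aemeasurable (μ := volume) (measurableSet_ball (x := (0:ℂ)) (ε := 1))
    exact (this.nnnorm.coe_nnreal_ennreal).pow_const 2
  have harea := aux_area φ hφ hφmaps N hN hfib _ hh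
  have hN0 : (N : ℝ≥0∞) ≠ 0 := by exact_mod_cast hN.ne'
  have hpt : ∀ z, (‖(c * deriv φ z / (Real.sqrt N : ℂ)) * f (φ z)‖₊ : ℝ≥0∞) ^ 2
      = (N : ℝ≥0∞)⁻¹ * (ENNReal.ofReal (‖deriv φ z‖ ^ 2) * (‖f (φ z)‖₊ : ℝ≥0∞) ^ 2) := by
    intro z
    have e : ∀ x : ℂ, (‖x‖₊ : ℝ≥0∞) ^ 2 = ENNReal.ofReal (‖x‖ ^ 2) := fun x => by
      rw [ENNReal.ofReal_pow (norm_nonneg _), ofReal_norm]; rfl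
    have hNr : (0:ℝ) < N := by exact_mod_cast hN
    rw [e, e, ← ENNReal.ofReal_natCast, ← ENNReal.ofReal_inv_of_pos hNr,
      ← ENNReal.ofReal_mul (by positivity), ← ENNReal.ofReal_mul (by positivity)]
    congr 1
    rw [norm_mul, norm_div, norm_mul, hc, Complex.norm_real, Real.norm_eq_abs,
      abs_of_nonneg (Real.sqrt_nonneg _), mul_pow, div_pow, Real.sq_sqrt hNr.le]
    ring
  simp_rw [hpt]
  rw [mDisc, lintegral_smul_measure, lintegral_smul_measure,
    lintegral_const_mul' _ _ (ENNReal.inv_ne_top.2 hN0), harea, ← mul_assoc,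
    ENNReal.inv_mul_cancel hN0 (ENNReal.natCast_ne_top N), one_mul]
end
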